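/- Fix c > 0 and p > 0. Then inf_G E[T_{oz}] ∼ 2n²/((p+2) log n) as n → ∞, i.e. the ratio of the two sides tends to 1, where the infimum runs over all weighted graphs G with a vertex o and a vertex set z satisfying dist(o,z) ≥ n and w_z/w_o < c n^p. -/

import Mathlib

open MeasureTheory Filter
open scoped Classical ENNReal

namespace RWHitting

/-- A weighted graph on a vertex set `V`: a symmetric weight function with
positive finite vertex weights. -/
structure WeightedGraph (V : Type*) where
  w : V → V → ℝ≥0∞
  symm : ∀ x y, w x y = w y x
  vw_pos : ∀ x, 0 < ∑' y, w x y
  vw_lt_top : ∀ x, ∑' y, w x y < ⊤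

namespace WeightedGraph

variable {V : Type*}

/-- The weight of a vertex. -/
noncomputable def vw (G : WeightedGraph V) (x : V) : ℝ≥0∞ := ∑' y, G.w x y

/-- The weight of a vertex set. -/
noncomputable def setWeight (G : WeightedGraph V) (z : Set V) : ℝ≥0∞ := ∑' x : z, G.vw x

/-- `G.distGE o z m` : every path of positive-weight steps from `o` into `z` has length `≥ m`. -/
def distGE (G : WeightedGraph V) (o : V) (z : Set V) (m : ℕ) : Prop :=
  ∀ (k : ℕ) (p : ℕ → V), p 0 = o → (∀ i, i < k → 0 < G.w (p i) (p (i+1))) → p k ∈ z → m ≤ k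

/-- Transition probabilities of the random walk on `G`. -/
noncomputable def trans (G : WeightedGraph V) (x y : V) : ℝ≥0∞ := G.w x y / G.vw x

/-- Graph distance (as an extended nonneg real). -/
noncomputable def edist (G : WeightedGraph V) (x y : V) : ℝ≥0∞ :=
  ⨅ (k : ℕ) (_ : ∃ p : ℕ → V, p 0 = x ∧ p k = y ∧ ∀ i, i < k → 0 < G.w (p i) (p (i+1))),
    (k : ℝ≥0∞)

/-- Total weight of the edges at distance `n` from `o` (each non-loop edge counted in both
orientations). -/
noncomputable def boundaryWeight (G : WeightedGraph V) (o : V) (n : ℕ) : ℝ≥0∞ :=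
  ∑' q : V × V, if min (G.edist o q.1) (G.edist o q.2) = (n : ℝ≥0∞) then G.w q.1 q.2 else 0

end WeightedGraph

variable {V : Type*}

/-- `μ` is the law of the random walk on `G` started at `o`. -/
def IsRandomWalk [MeasurableSpace V] (G : WeightedGraph V) (o : V)
    (μ : Measure (ℕ → V)) : Prop :=
  IsProbabilityMeasure μ ∧
  ∀ (k : ℕ) (x : Fin (k+1) → V),
    μ {ω | ∀ i : Fin (k+1), ω (i : ℕ) = x i}
      = (if x 0 = o then 1 else 0) * ∏ i : Fin k, G.trans (x i.castSucc) (x i.succ)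

/-- First hitting time of the set `z` (`∞` if `z` is never visited). -/
noncomputable def hitTime (z : Set V) (ω : ℕ → V) : ℝ≥0∞ :=
  ⨅ (k : ℕ) (_ : ω k ∈ z), (k : ℝ≥0∞)

/-- Expected hitting time of `z`. -/
noncomputable def expHit [MeasurableSpace V] (μ : Measure (ℕ → V)) (z : Set V) : ℝ≥0∞ :=
  ∫⁻ ω, hitTime z ω ∂μ

/-- Number of visits to `o` (counting time 0) strictly before hitting `z`. -/
noncomputable def visitsBefore (z : Set V) (o : V) (ω : ℕ → V) : ℝ≥0∞ :=
  ∑' k : ℕ, if ω k = o ∧ (k : ℝ≥0∞) < hitTime z ω then 1 else 0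

/-- Effective resistance between `o` and `z`, defined probabilistically via the random walk
law `μ`:  `w_o r_{oz}` is the expected number of visits to `o` before hitting `z`. -/
noncomputable def resistance [MeasurableSpace V] (G : WeightedGraph V) (o : V) (z : Set V)
    (μ : Measure (ℕ → V)) : ℝ≥0∞ :=
  (∫⁻ ω, visitsBefore z o ω ∂μ) / G.vw o

/-- One-step transition probabilities for the biased simple random walk on `ℤ`
with odds `1 : g` of going left/right. -/
noncomputable def biasedStep (g : ℝ) (a b : ℤ) : ℝ≥0∞ :=
  if b = a + 1 then ENNReal.ofReal (g / (g+1))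
  else if b = a - 1 then ENNReal.ofReal (1 / (g+1)) else 0

/-- `ν` is the law of the biased simple random walk on `ℤ` started at `0`,
stepping right with probability `g/(g+1)` and left with probability `1/(g+1)`. -/
def IsBiasedWalk (g : ℝ) (ν : Measure (ℕ → ℤ)) : Prop :=
  IsProbabilityMeasure ν ∧
  ∀ (k : ℕ) (x : Fin (k+1) → ℤ),
    ν {ω | ∀ i : Fin (k+1), ω (i : ℕ) = x i}
      = (if x 0 = 0 then 1 else 0) * ∏ i : Fin k, biasedStep g (x i.castSucc) (x i.succ)

/-- `e^{-λ t}` for an extended-real time `t`, with the convention `e^{-λ ∞} = 0`. -/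
noncomputable def expNeg (lam : ℝ) (t : ℝ≥0∞) : ℝ≥0∞ :=
  if t = ⊤ then 0 else ENNReal.ofReal (Real.exp (-lam * t.toReal))


/-- The set of expected hitting times `E T_{oz}` over all weighted graphs (with vertex set
indexed by `ℕ`) with `dist(o,z) ≥ n` and `w_z/w_o < c n^p`. -/
def ETsetPoly (c p : ℝ) (n : ℕ) : Set ℝ≥0∞ :=
  {t | ∃ (G : WeightedGraph ℕ) (o : ℕ) (z : Set ℕ) (μ : Measure (ℕ → ℕ)),
    IsRandomWalk G o μ ∧ G.distGE o z n ∧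
    G.setWeight z / G.vw o < ENNReal.ofReal (c * (n : ℝ) ^ p) ∧
    t = expHit μ z}

/-! ### The walk killed on `z` -/

/-- Probability that the walk has avoided `z` up to time `k` and is at `x` at time `k`. -/
noncomputable def aliveAt (μ : Measure (ℕ → ℕ)) (z : Set ℕ) (k x : ℕ) : ℝ≥0∞ :=
  μ {ω | (∀ i ≤ k, ω i ∉ z) ∧ ω k = x}

/-- Expected number of visits to `x` before hitting `z`. -/
noncomputable def expVisits (μ : Measure (ℕ → ℕ)) (z : Set ℕ) (x : ℕ) : ℝ≥0∞ :=
  ∑' k, aliveAt μ z k x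

lemma measurableSet_avoid (z : Set ℕ) (k : ℕ) :
    MeasurableSet {ω : ℕ → ℕ | ∀ i ≤ k, ω i ∉ z} := by
  have : {ω : ℕ → ℕ | ∀ i ≤ k, ω i ∉ z} = ⋂ i, ⋂ (_ : i ≤ k), (fun ω : ℕ → ℕ => ω i) ⁻¹' zᶜ := by
    ext ω; simp
  rw [this]
  exact MeasurableSet.iInter fun i => MeasurableSet.iInter fun _ =>
    measurable_pi_apply i (MeasurableSet.of_discrete)

lemma measurableSet_eval_eq (k x : ℕ) : MeasurableSet {ω : ℕ → ℕ | ω k = x} := by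
  have h : MeasurableSet ((fun ω : ℕ → ℕ => ω k) ⁻¹' {x}) :=
    measurable_pi_apply k (measurableSet_singleton x)
  exact h

/-- The first `k + 1` positions of a trajectory. -/
def headPath (k : ℕ) (ω : ℕ → ℕ) : Fin (k + 1) → ℕ := fun i => ω i

lemma measurable_headPath (k : ℕ) : Measurable (headPath k) :=
  measurable_pi_lambda _ fun i => measurable_pi_apply (i : ℕ)

lemma measure_eq_tsum_headPath (μ : Measure (ℕ → ℕ)) (k : ℕ) {s : Set (ℕ → ℕ)} :
    μ s = ∑' q : Fin (k + 1) → ℕ, μ (headPath k ⁻¹' {q} ∩ s) := by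
  have hm : ∀ q, MeasurableSet (headPath k ⁻¹' {q}) := fun q =>
    measurable_headPath k (measurableSet_singleton q)
  have h := tsum_measure_preimage_singleton (μ := μ.restrict s)
    (s := (Set.univ : Set (Fin (k + 1) → ℕ))) Set.countable_univ (f := headPath k)
    (fun q _ => hm q)
  rw [tsum_univ (fun q => (μ.restrict s) (headPath k ⁻¹' {q}))] at h
  simp only [Measure.restrict_apply (hm _), Set.preimage_univ, Measure.restrict_apply_univ] at h
  exact h.symm

section Walk

variable {G : WeightedGraph ℕ} {o : ℕ} {μ : Measure (ℕ → ℕ)} {z : Set ℕ}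

lemma IsRandomWalk.measure_headPath_succ (hμ : IsRandomWalk G o μ) (k y : ℕ)
    (q : Fin (k + 1) → ℕ) :
    μ (headPath k ⁻¹' {q} ∩ {ω | ω (k + 1) = y})
      = μ (headPath k ⁻¹' {q}) * G.trans (q (Fin.last k)) y := by
  have h1 : headPath k ⁻¹' {q} = {ω | ∀ i : Fin (k + 1), ω (i : ℕ) = q i} := by
    ext ω; simp [headPath, funext_iff]
  have h2 : headPath k ⁻¹' {q} ∩ {ω | ω (k + 1) = y}
      = {ω | ∀ i : Fin (k + 1 + 1), ω (i : ℕ) = (Fin.snoc q y : Fin (k + 1 + 1) → ℕ) i} := by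
    ext ω
    rw [h1]
    simp [Fin.forall_fin_succ' (n := k + 1)]
  rw [h2, h1, hμ.2, hμ.2, Fin.prod_univ_castSucc, ← mul_assoc]
  congr 1
  · have : (Fin.snoc q y : Fin (k + 1 + 1) → ℕ) 0 = q 0 := by
      have h0 : (0 : Fin (k + 1 + 1)) = Fin.castSucc 0 := rfl
      rw [h0, Fin.snoc_castSucc]
    rw [this]
    congr 1
    · refine Finset.prod_congr rfl fun i _ => ?_
      rw [Fin.succ_castSucc, Fin.snoc_castSucc, Fin.snoc_castSucc]
  · rw [Fin.succ_last, Fin.snoc_last, Fin.snoc_castSucc]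

lemma IsRandomWalk.aliveAt_zero (hμ : IsRandomWalk G o μ) (ho : o ∉ z) (x : ℕ) :
    aliveAt μ z 0 x = if x = o then 1 else 0 := by
  have h := hμ.2 0 (fun _ => x)
  simp only [Finset.univ_eq_empty, Finset.prod_empty, mul_one] at h
  unfold aliveAt
  by_cases hx : x ∈ z
  · have : {ω : ℕ → ℕ | (∀ i ≤ 0, ω i ∉ z) ∧ ω 0 = x} = ∅ := by
      ext ω; simp; rintro h1 rfl; exact h1 hx
    rw [this, if_neg (by rintro rfl; exact ho hx)]; simp
  · refine Eq.trans ?_ (h.trans (by congr))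
    congr 1
    ext ω
    simp only [Set.mem_ofPred_eq]
    constructor
    · rintro ⟨_, h⟩ i
      have : i = 0 := Fin.ext (by omega)
      subst this; exact h
    · intro h
      have := h 0
      simp only [Fin.val_zero] at this
      refine ⟨fun i hi => ?_, this⟩
      obtain rfl : i = 0 := by omega
      rwa [this]

lemma IsRandomWalk.aliveAt_succ (hμ : IsRandomWalk G o μ) (k y : ℕ) :
    aliveAt μ z (k + 1) y = if y ∈ z then 0 else ∑' x, aliveAt μ z k x * G.trans x y := by
  split_ifs with hy
  · rw [aliveAt]
    convert measure_empty (μ := μ)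
    ext ω
    simp only [Set.mem_ofPred_eq, Set.mem_empty_iff_false, iff_false]
    rintro ⟨h1, rfl⟩
    exact h1 _ le_rfl hy
  · have key : ∀ q : Fin (k + 1) → ℕ,
        μ (headPath k ⁻¹' {q} ∩ {ω | (∀ i ≤ k + 1, ω i ∉ z) ∧ ω (k + 1) = y})
          = (if ∀ i, q i ∉ z then μ (headPath k ⁻¹' {q}) else 0)
            * G.trans (q (Fin.last k)) y := by
      intro q
      split_ifs with hq
      · rw [← hμ.measure_headPath_succ]
        congr 1
        ext ω
        simp only [Set.mem_inter_iff, Set.mem_preimage, Set.mem_singleton_iff, Set.mem_ofPred_eq,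
          and_congr_right_iff, and_iff_right_iff_imp]
        rintro rfl h i hi
        rcases Nat.lt_or_ge i (k + 1) with h1 | h1
        · exact hq ⟨i, h1⟩
        · obtain rfl : i = k + 1 := by omega
          rwa [h]
      · rw [zero_mul]
        convert measure_empty (μ := μ)
        ext ω
        simp only [Set.mem_inter_iff, Set.mem_preimage, Set.mem_singleton_iff, Set.mem_ofPred_eq,
          Set.mem_empty_iff_false, iff_false]
        rintro ⟨rfl, h, -⟩
        exact hq fun i => h i (by omega)
    have key2 : ∀ (x : ℕ) (q : Fin (k + 1) → ℕ),
        μ (headPath k ⁻¹' {q} ∩ {ω | (∀ i ≤ k, ω i ∉ z) ∧ ω k = x})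
          = if x = q (Fin.last k) then
              (if ∀ i, q i ∉ z then μ (headPath k ⁻¹' {q}) else 0) else 0 := by
      intro x q
      split_ifs with hx hq
      · congr 1
        ext ω
        simp only [Set.mem_inter_iff, Set.mem_preimage, Set.mem_singleton_iff, Set.mem_ofPred_eq,
          and_iff_left_iff_imp]
        rintro rfl
        exact ⟨fun i hi => hq ⟨i, by omega⟩, hx.symm⟩
      · convert measure_empty (μ := μ)
        ext ω
        simp only [Set.mem_inter_iff, Set.mem_preimage, Set.mem_singleton_iff, Set.mem_ofPred_eq,
          Set.mem_empty_iff_false, iff_false]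
        rintro ⟨rfl, h, -⟩
        exact hq fun i => h i (by omega)
      · convert measure_empty (μ := μ)
        ext ω
        simp only [Set.mem_inter_iff, Set.mem_preimage, Set.mem_singleton_iff, Set.mem_ofPred_eq,
          Set.mem_empty_iff_false, iff_false]
        rintro ⟨rfl, -, h⟩
        exact hx h.symm
    rw [aliveAt, measure_eq_tsum_headPath μ k]
    simp only [key]
    have : ∀ x, aliveAt μ z k x * G.trans x y
        = ∑' q : Fin (k + 1) → ℕ, if x = q (Fin.last k) then
            (if ∀ i, q i ∉ z then μ (headPath k ⁻¹' {q}) else 0) * G.trans x y else 0 := by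
      intro x
      rw [aliveAt, measure_eq_tsum_headPath μ k, ← ENNReal.tsum_mul_right]
      refine tsum_congr fun q => ?_
      rw [key2, ite_mul, zero_mul]
    simp only [this]
    rw [ENNReal.tsum_comm]
    refine tsum_congr fun q => ?_
    rw [tsum_ite_eq]

lemma hitTime_eq_tsum (z : Set ℕ) (ω : ℕ → ℕ) :
    hitTime z ω = ∑' k : ℕ, {ω : ℕ → ℕ | ∀ i ≤ k, ω i ∉ z}.indicator 1 ω := by
  rw [hitTime]
  by_cases h : ∃ k, ω k ∈ z
  · have h1 : ∀ k, {ω : ℕ → ℕ | ∀ i ≤ k, ω i ∉ z}.indicator (1 : (ℕ → ℕ) → ℝ≥0∞) ω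
        = if k ∈ Finset.range (Nat.find h) then 1 else 0 := by
      intro k
      rw [Set.indicator_apply]
      congr 1
      simp only [Set.mem_ofPred_eq, Finset.mem_range, Nat.lt_find_iff]
    simp only [h1]
    rw [tsum_eq_sum (s := Finset.range (Nat.find h)) (by intro b hb; simp [hb])]
    rw [Finset.sum_ite_mem, Finset.inter_self, Finset.sum_const, Finset.card_range, nsmul_eq_mul,
      mul_one]
    refine le_antisymm (iInf₂_le (Nat.find h) (Nat.find_spec h)) (le_iInf₂ fun k hk => ?_)
    exact_mod_cast Nat.find_min' h hk
  · push Not at h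
    simp [h]

lemma lintegral_hitTime (μ : Measure (ℕ → ℕ)) (z : Set ℕ) :
    expHit μ z = ∑' k, ∑' x, aliveAt μ z k x := by
  rw [expHit]
  simp only [hitTime_eq_tsum]
  rw [lintegral_tsum fun k =>
    ((measurable_one).indicator (measurableSet_avoid z k)).aemeasurable]
  refine tsum_congr fun k => ?_
  rw [lintegral_indicator_one (measurableSet_avoid z k)]
  have h := tsum_measure_preimage_singleton (μ := μ.restrict {ω : ℕ → ℕ | ∀ i ≤ k, ω i ∉ z})
    (s := (Set.univ : Set ℕ)) Set.countable_univ (f := fun ω => ω k)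
    (fun q _ => measurableSet_eval_eq k q)
  rw [tsum_univ (fun q => (μ.restrict _) ((fun ω : ℕ → ℕ => ω k) ⁻¹' {q}))] at h
  rw [Set.preimage_univ, Measure.restrict_apply_univ] at h
  rw [← h]
  refine tsum_congr fun x => ?_
  refine (Measure.restrict_apply (measurableSet_eval_eq k x)).trans ?_
  rw [aliveAt, Set.inter_comm]
  rfl

lemma expHit_eq_tsum_expVisits (μ : Measure (ℕ → ℕ)) (z : Set ℕ) :
    expHit μ z = ∑' x, expVisits μ z x := by
  rw [lintegral_hitTime, ENNReal.tsum_comm]; rfl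

lemma IsRandomWalk.expVisits_eq (hμ : IsRandomWalk G o μ) (ho : o ∉ z) (y : ℕ) :
    expVisits μ z y
      = if y ∈ z then 0 else (if y = o then 1 else 0) + ∑' x, expVisits μ z x * G.trans x y := by
  rw [expVisits, tsum_eq_zero_add' ENNReal.summable, hμ.aliveAt_zero ho]
  simp only [hμ.aliveAt_succ]
  by_cases hy : y ∈ z
  · have hyo : y ≠ o := fun h => ho (h ▸ hy)
    simp [hy, hyo]
  · simp only [if_neg hy]
    rw [ENNReal.tsum_comm]
    simp only [ENNReal.tsum_mul_right, expVisits]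

lemma IsRandomWalk.expHit_le (hμ : IsRandomWalk G o μ) (ho : o ∉ z) (h : ℕ → ℝ≥0∞)
    (hh : ∀ x, x ∉ z → 1 + ∑' y, G.trans x y * h y ≤ h x) : expHit μ z ≤ h o := by
  rw [lintegral_hitTime, ENNReal.tsum_eq_iSup_nat]
  refine iSup_le fun K => ?_
  suffices H : ∑ k ∈ Finset.range K, ∑' x, aliveAt μ z k x + ∑' x, aliveAt μ z K x * h x ≤ h o from
    le_trans le_self_add H
  induction K with
  | zero => simp [hμ.aliveAt_zero ho]
  | succ K ih =>
    refine le_trans ?_ ih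
    rw [Finset.sum_range_succ, add_assoc]
    gcongr
    have h1 : ∑' y, aliveAt μ z (K + 1) y * h y
        ≤ ∑' x, aliveAt μ z K x * ∑' y, G.trans x y * h y := by
      calc ∑' y, aliveAt μ z (K + 1) y * h y
          ≤ ∑' y, ∑' x, aliveAt μ z K x * (G.trans x y * h y) := by
            refine ENNReal.tsum_le_tsum fun y => ?_
            rw [hμ.aliveAt_succ]
            split_ifs
            · simp
            · rw [← ENNReal.tsum_mul_right]
              simp only [mul_assoc]; rfl
        _ = _ := by
            rw [ENNReal.tsum_comm]
            simp only [ENNReal.tsum_mul_left]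
    refine le_trans (add_le_add le_rfl h1) ?_
    rw [← ENNReal.tsum_add]
    refine ENNReal.tsum_le_tsum fun x => ?_
    by_cases hx : x ∈ z
    · have : aliveAt μ z K x = 0 := by
        rw [aliveAt]
        convert measure_empty (μ := μ)
        ext ω
        simp only [Set.mem_ofPred_eq, Set.mem_empty_iff_false, iff_false]
        rintro ⟨h1, rfl⟩
        exact h1 _ le_rfl hx
      simp [this]
    · calc aliveAt μ z K x + aliveAt μ z K x * ∑' y, G.trans x y * h y
          = aliveAt μ z K x * (1 + ∑' y, G.trans x y * h y) := by ring
        _ ≤ _ := by gcongr; exact hh x hx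

lemma WeightedGraph.tsum_trans (G : WeightedGraph ℕ) (x : ℕ) : ∑' y, G.trans x y = 1 := by
  simp only [WeightedGraph.trans, div_eq_mul_inv]
  rw [ENNReal.tsum_mul_right]
  exact ENNReal.mul_inv_cancel (G.vw_pos x).ne' (G.vw_lt_top x).ne

end Walk

/-! ### Existence of the walk -/

/-- The trajectory which, when at `x` at time `k`, moves to `ξ (k, x)`. -/
def drive (o : ℕ) (ξ : ℕ × ℕ → ℕ) : ℕ → ℕ
  | 0 => o
  | k + 1 => ξ (k, drive o ξ k)

lemma measurable_drive (o : ℕ) : Measurable (drive o) := by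
  refine measurable_pi_lambda _ fun k => ?_
  induction k with
  | zero => exact measurable_const
  | succ k ih =>
    have h : Measurable fun q : ℕ × (ℕ × ℕ → ℕ) => q.2 (k, q.1) :=
      measurable_from_prod_countable_right fun x => measurable_pi_apply (k, x)
    exact h.comp (ih.prodMk measurable_id)

lemma exists_isRandomWalk (G : WeightedGraph ℕ) (o : ℕ) :
    ∃ μ : Measure (ℕ → ℕ), IsRandomWalk G o μ := by
  let step : ℕ → PMF ℕ := fun x => ⟨G.trans x, by
    rw [← G.tsum_trans x]; exact ENNReal.summable.hasSum⟩
  let ν : Measure (ℕ × ℕ → ℕ) := Measure.infinitePi fun q : ℕ × ℕ => (step q.2).toMeasure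
  refine ⟨ν.map (drive o), Measure.isProbabilityMeasure_map (measurable_drive o).aemeasurable,
    fun k x => ?_⟩
  have hmeas : MeasurableSet {ω : ℕ → ℕ | ∀ i : Fin (k + 1), ω (i : ℕ) = x i} := by
    simp only [Set.ofPred_forall]
    exact MeasurableSet.iInter fun i => measurableSet_eval_eq _ _
  rw [Measure.map_apply (measurable_drive o) hmeas]
  by_cases h0 : x 0 = o
  · rw [if_pos h0, one_mul]
    have hinj : Function.Injective fun i : Fin k => ((i : ℕ), x i.castSucc) := by
      intro i j h
      simp only [Prod.mk.injEq] at h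
      exact Fin.ext h.1
    let s : Finset (ℕ × ℕ) := Finset.univ.map ⟨_, hinj⟩
    let t : ℕ × ℕ → Set ℕ := fun q => {y | ∀ i : Fin k, (i : ℕ) = q.1 → y = x i.succ}
    have hset : drive o ⁻¹' {ω : ℕ → ℕ | ∀ i : Fin (k + 1), ω (i : ℕ) = x i} = Set.pi s t := by
      ext ξ
      simp only [Set.mem_preimage, Set.mem_ofPred_eq, Set.mem_pi, Finset.mem_coe, s, t,
        Finset.mem_map, Finset.mem_univ, true_and, Function.Embedding.coeFn_mk,
        forall_exists_index, forall_apply_eq_imp_iff]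
      constructor
      · intro h j i hij
        have hij' : i = j := Fin.ext hij
        subst hij'
        have h1 := h i.succ
        have h2 := h i.castSucc
        simp only [Fin.val_succ, drive, Fin.val_castSucc] at h1 h2
        rw [← h1, h2]
      · intro h i
        induction i using Fin.induction with
        | zero => simp [drive, h0]
        | succ i ih =>
          simp only [Fin.val_castSucc] at ih
          simp only [Fin.val_succ, drive, ih]
          exact h i i rfl
    rw [hset, Measure.infinitePi_pi _ (fun _ _ => MeasurableSet.of_discrete), Finset.prod_map]
    refine Finset.prod_congr rfl fun i _ => ?_
    simp only [Function.Embedding.coeFn_mk]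
    have : t ((i : ℕ), x i.castSucc) = {x i.succ} := by
      ext y
      simp only [t, Set.mem_ofPred_eq, Set.mem_singleton_iff]
      exact ⟨fun h => h i rfl, fun h j hj => by rw [h, Fin.ext hj]⟩
    rw [this, PMF.toMeasure_apply_singleton _ _ (measurableSet_singleton _)]
    rfl
  · rw [if_neg h0, zero_mul]
    convert measure_empty (μ := ν)
    ext ξ
    simp only [Set.mem_preimage, Set.mem_ofPred_eq, Set.mem_empty_iff_false, iff_false]
    intro h
    exact h0 (h 0).symm

/-! ### The entropy inequality for the occupation measure -/

/-- `x` truncated to `[δ, M]`. -/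
noncomputable def clampTo (δ M x : ℝ) : ℝ := max δ (min M x)

/-- `x - clampTo δ M x + δ`, the part of `x` lost by truncation. -/
noncomputable def clampErr (δ M x : ℝ) : ℝ := x - clampTo δ M x + δ

lemma clampErr_eq {δ M : ℝ} (hM : δ ≤ M) (x : ℝ) :
    clampErr δ M x = min x δ + max 0 (x - M) := by
  unfold clampErr clampTo
  rcases le_total M x with h1 | h1 <;> rcases le_total x δ with h2 | h2 <;>
    simp [h1, h2, hM] <;> grind

lemma log_mul_sub_le {a b : ℝ} (hb : 0 < b) (hab : b ≤ a) :
    2 * (a - b) ≤ (Real.log a - Real.log b) * (a + b) := by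
  have ha : 0 < a := hb.trans_le hab
  have h := Real.le_log_one_add_of_nonneg (x := a / b - 1)
    (by rw [sub_nonneg, le_div_iff₀ hb]; linarith)
  rw [show 1 + (a / b - 1) = a / b by ring, Real.log_div ha.ne' hb.ne',
    show 2 * (a / b - 1) / (a / b - 1 + 2) = 2 * (a - b) / (a + b) by
      rw [show a / b - 1 + 2 = (a + b) / b by field_simp; ring]
      field_simp, div_le_iff₀ (by positivity)] at h
  exact h

lemma edge_inequality {δ M l a b d e : ℝ} (hδ : 0 < δ) (hM : δ ≤ M) (hl : 0 ≤ l)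
    (ha : 0 ≤ a) (hb : 0 ≤ b) (hde : |d - e| ≤ 1) :
    2 * (a - b) * ((2 * l * e + l ^ 2 * Real.log (clampTo δ M b))
        - (2 * l * d + l ^ 2 * Real.log (clampTo δ M a)))
      ≤ a + b + (4 * l + 1) * (clampErr δ M a + clampErr δ M b) := by
  wlog hab : b ≤ a generalizing a b d e with H
  · have := H hb ha (by rwa [abs_sub_comm]) (le_of_not_ge hab) (d := e) (e := d)
    linarith
  have hea := clampErr_eq hM a
  have heb := clampErr_eq hM b
  have hea0 : 0 ≤ clampErr δ M a := by rw [hea]; positivity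
  have heb0 : 0 ≤ clampErr δ M b := by rw [heb]; positivity
  have hee : clampErr δ M b ≤ clampErr δ M a := by rw [hea, heb]; gcongr
  have hcc : clampTo δ M b ≤ clampTo δ M a := by unfold clampTo; gcongr
  have hcb : 0 < clampTo δ M b := lt_max_of_lt_left hδ
  set A := clampTo δ M a with hA
  set B := clampTo δ M b with hB
  set s := Real.log A - Real.log B with hs
  have hs0 : 0 ≤ s := sub_nonneg.2 (Real.log_le_log hcb hcc)
  have hde' := (abs_le.1 hde).1
  have hφ : (2 * l * e + l ^ 2 * Real.log B) - (2 * l * d + l ^ 2 * Real.log A)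
      ≤ 2 * l - l ^ 2 * s := by
    rw [hs]; nlinarith
  have hsplit : a - b = (A - B) + (clampErr δ M a - clampErr δ M b) := by
    unfold clampErr; ring
  have h1 : 2 * (a - b) * ((2 * l * e + l ^ 2 * Real.log B)
      - (2 * l * d + l ^ 2 * Real.log A)) ≤ 2 * (a - b) * (2 * l - l ^ 2 * s) := by
    gcongr
  have h2 : 2 * (clampErr δ M a - clampErr δ M b) * (2 * l - l ^ 2 * s)
      ≤ 4 * l * (clampErr δ M a + clampErr δ M b) := by
    have : 2 * l - l ^ 2 * s ≤ 2 * l := by nlinarith [sq_nonneg l]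
    calc _ ≤ 2 * (clampErr δ M a - clampErr δ M b) * (2 * l) := by gcongr
      _ ≤ _ := by nlinarith
  have h3 : 2 * (A - B) * (2 * l - l ^ 2 * s) ≤ a + b + (clampErr δ M a + clampErr δ M b) := by
    rcases hcc.eq_or_lt with h | h
    · rw [← h]; nlinarith
    · have h4 : 2 * (A - B) * (2 * l - l ^ 2 * s) ≤ A + B := by
        have h5 := log_mul_sub_le hcb hcc
        rw [← hs] at h5
        have hspos : 0 < s := by
          have : 0 < A + B := by linarith
          by_contra hcon
          have : s * (A + B) ≤ 0 := mul_nonpos_of_nonpos_of_nonneg (by linarith) this.le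
          linarith
        have h6 : (2 * l - l ^ 2 * s) * s ≤ 1 := by nlinarith [sq_nonneg (l * s - 1)]
        by_cases h7 : 0 ≤ 2 * l - l ^ 2 * s
        · calc 2 * (A - B) * (2 * l - l ^ 2 * s)
              ≤ s * (A + B) * (2 * l - l ^ 2 * s) := by gcongr
            _ = (A + B) * ((2 * l - l ^ 2 * s) * s) := by ring
            _ ≤ (A + B) * 1 := by gcongr; linarith
            _ = A + B := mul_one _
        · have : 2 * (A - B) * (2 * l - l ^ 2 * s) ≤ 0 :=
            mul_nonpos_of_nonneg_of_nonpos (by linarith) (by linarith)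
          linarith
      have haδ : δ < a := by
        by_contra hcon
        have : A ≤ δ := max_le le_rfl ((min_le_right _ _).trans (by linarith))
        have : δ ≤ B := le_max_left _ _
        linarith
      have hAa : A ≤ a := max_le haδ.le (min_le_right _ _)
      have hBb : B ≤ b + δ := max_le (by linarith) ((min_le_right _ _).trans (by linarith))
      have : δ ≤ clampErr δ M a := by unfold clampErr; linarith
      linarith
  calc _ ≤ _ := h1
    _ = 2 * (A - B) * (2 * l - l ^ 2 * s)
        + 2 * (clampErr δ M a - clampErr δ M b) * (2 * l - l ^ 2 * s) := by rw [hsplit]; ring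
    _ ≤ _ := by linarith

/-- `N` is the occupation measure of a walk started at `o` and killed on `z`, on the graph
with edge weights `w` and vertex weights `W`. -/
structure IsOccupation (w : ℕ → ℕ → ℝ) (W : ℕ → ℝ) (o : ℕ) (z : Set ℕ) (N : ℕ → ℝ) : Prop where
  w_nonneg : ∀ x y, 0 ≤ w x y
  w_symm : ∀ x y, w x y = w y x
  hasSum_w : ∀ x, HasSum (w x) (W x)
  W_pos : ∀ x, 0 < W x
  N_nonneg : ∀ x, 0 ≤ N x
  summable_N : Summable N
  N_eq_zero : ∀ x ∈ z, N x = 0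
  o_notMem : o ∉ z
  balance : ∀ y ∉ z, HasSum (fun x => N x / W x * w x y) (N y - if y = o then 1 else 0)

namespace IsOccupation

variable {w : ℕ → ℕ → ℝ} {W : ℕ → ℝ} {o : ℕ} {z : Set ℕ} {N : ℕ → ℝ}

lemma hasSum_flow (h : IsOccupation w W o z N) (x : ℕ) :
    HasSum (fun y => N x / W x * w x y) (N x) := by
  have := (h.hasSum_w x).mul_left (N x / W x)
  rwa [div_mul_cancel₀ _ (h.W_pos x).ne'] at this

lemma flow_nonneg (h : IsOccupation w W o z N) (x y : ℕ) : 0 ≤ N x / W x * w x y :=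
  mul_nonneg (div_nonneg (h.N_nonneg x) (h.W_pos x).le) (h.w_nonneg x y)

lemma summable_flow (h : IsOccupation w W o z N) :
    Summable fun q : ℕ × ℕ => N q.1 / W q.1 * w q.1 q.2 := by
  rw [summable_prod_of_nonneg fun q => h.flow_nonneg q.1 q.2]
  refine ⟨fun x => (h.hasSum_flow x).summable, ?_⟩
  simp only [(h.hasSum_flow _).tsum_eq]
  exact h.summable_N

lemma summable_mul_flow (h : IsOccupation w W o z N) {ψ : ℕ × ℕ → ℝ} {K : ℝ}
    (hψ : ∀ q, |ψ q| ≤ K) : Summable fun q : ℕ × ℕ => ψ q * (N q.1 / W q.1 * w q.1 q.2) := by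
  refine Summable.of_norm_bounded (h.summable_flow.mul_left K) fun q => ?_
  rw [norm_mul, Real.norm_eq_abs, Real.norm_of_nonneg (h.flow_nonneg _ _)]
  exact mul_le_mul_of_nonneg_right (hψ q) (h.flow_nonneg _ _)

/-- The flow from `x` into `z`. -/
noncomputable def exitFlow (w : ℕ → ℕ → ℝ) (W : ℕ → ℝ) (z : Set ℕ) (N : ℕ → ℝ) (x : ℕ) : ℝ :=
  ∑' y, z.indicator 1 y * (N x / W x * w x y)

lemma abs_indicator_le (z : Set ℕ) (y : ℕ) : |z.indicator (1 : ℕ → ℝ) y| ≤ 1 := by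
  by_cases hy : y ∈ z <;> simp [hy]

lemma green_identity (h : IsOccupation w W o z N) {φ : ℕ → ℝ} {K : ℝ} (hφ : ∀ x, |φ x| ≤ K) :
    Summable (fun x => φ x * exitFlow w W z N x) ∧
    ∑' q : ℕ × ℕ, zᶜ.indicator 1 q.2 * (φ q.2 - φ q.1) * (N q.1 / W q.1 * w q.1 q.2)
      = ∑' x, φ x * exitFlow w W z N x - φ o := by
  have s1 : Summable fun q : ℕ × ℕ =>
      (zᶜ.indicator 1 q.2 * φ q.2) * (N q.1 / W q.1 * w q.1 q.2) :=
    h.summable_mul_flow (ψ := fun q => zᶜ.indicator 1 q.2 * φ q.2) (K := K) fun q => by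
      rw [abs_mul]
      exact (mul_le_mul (abs_indicator_le _ _) (hφ _) (abs_nonneg _) zero_le_one).trans_eq
        (one_mul K)
  have s2 : Summable fun q : ℕ × ℕ => φ q.1 * (N q.1 / W q.1 * w q.1 q.2) :=
    h.summable_mul_flow (ψ := fun q => φ q.1) fun q => hφ _
  have s3 : Summable fun q : ℕ × ℕ =>
      (z.indicator 1 q.2 * φ q.1) * (N q.1 / W q.1 * w q.1 q.2) :=
    h.summable_mul_flow (ψ := fun q => z.indicator 1 q.2 * φ q.1) (K := K) fun q => by
      rw [abs_mul]
      exact (mul_le_mul (abs_indicator_le _ _) (hφ _) (abs_nonneg _) zero_le_one).trans_eq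
        (one_mul K)
  have sN : Summable fun x => φ x * N x := by
    refine Summable.of_norm_bounded (h.summable_N.mul_left K) fun x => ?_
    rw [norm_mul, Real.norm_eq_abs, Real.norm_of_nonneg (h.N_nonneg _)]
    exact mul_le_mul_of_nonneg_right (hφ x) (h.N_nonneg _)
  have e1 : ∑' q : ℕ × ℕ, (zᶜ.indicator 1 q.2 * φ q.2) * (N q.1 / W q.1 * w q.1 q.2)
      = ∑' y, φ y * N y - φ o := by
    rw [← (Equiv.prodComm ℕ ℕ).tsum_eq]
    refine (Summable.tsum_prod ((Equiv.prodComm ℕ ℕ).summable_iff.2 s1)).trans ?_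
    have : ∀ y, ∑' x, (zᶜ.indicator 1 y * φ y) * (N x / W x * w x y)
        = φ y * N y - if y = o then φ o else 0 := by
      intro y
      rw [tsum_mul_left]
      by_cases hy : y ∈ z
      · have : y ≠ o := fun e => h.o_notMem (e ▸ hy)
        simp [hy, h.N_eq_zero y hy, this]
      · rw [(h.balance y hy).tsum_eq]
        by_cases hyo : y = o
        · subst hyo; simp [hy]; ring
        · simp [hy, hyo]
    simp only [Function.comp_apply, Equiv.prodComm_apply, Prod.swap_prod_mk, this]
    rw [Summable.tsum_sub sN (summable_of_ne_finset_zero (s := {o}) (by simp +contextual)),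
      tsum_ite_eq]
  have e2 : ∑' q : ℕ × ℕ, φ q.1 * (N q.1 / W q.1 * w q.1 q.2) = ∑' x, φ x * N x := by
    rw [s2.tsum_prod]
    simp only [tsum_mul_left, (h.hasSum_flow _).tsum_eq]
  have f3 : ∀ x, ∑' y, (z.indicator 1 y * φ x) * (N x / W x * w x y)
      = φ x * exitFlow w W z N x := by
    intro x
    rw [exitFlow, ← tsum_mul_left]
    refine tsum_congr fun y => ?_
    ring
  have e3 : ∑' q : ℕ × ℕ, (z.indicator 1 q.2 * φ q.1) * (N q.1 / W q.1 * w q.1 q.2)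
      = ∑' x, φ x * exitFlow w W z N x := by
    rw [s3.tsum_prod]
    simp only [f3]
  refine ⟨?_, ?_⟩
  · have := s3.prod
    simpa only [f3] using this
  · have : ∀ q : ℕ × ℕ, zᶜ.indicator 1 q.2 * (φ q.2 - φ q.1) * (N q.1 / W q.1 * w q.1 q.2)
        = (zᶜ.indicator 1 q.2 * φ q.2) * (N q.1 / W q.1 * w q.1 q.2)
          - φ q.1 * (N q.1 / W q.1 * w q.1 q.2)
          + (z.indicator 1 q.2 * φ q.1) * (N q.1 / W q.1 * w q.1 q.2) := by
      intro q
      by_cases hq : q.2 ∈ z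
      · simp [hq]
      · simp [hq]; ring
    simp only [this]
    rw [Summable.tsum_add (s1.sub s2) s3, Summable.tsum_sub s1 s2, e1, e2, e3]
    ring

lemma hasSum_exitFlow (h : IsOccupation w W o z N) : HasSum (exitFlow w W z N) 1 := by
  obtain ⟨h1, h2⟩ := h.green_identity (φ := fun _ => 1) (K := 1) (by simp)
  simp only [one_mul, sub_self, mul_zero, zero_mul, tsum_zero] at h1 h2
  have := h1.hasSum
  rwa [show ∑' x, exitFlow w W z N x = 1 by linarith] at this

lemma exitFlow_nonneg (h : IsOccupation w W o z N) (x : ℕ) : 0 ≤ exitFlow w W z N x :=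
  tsum_nonneg fun y => mul_nonneg (Set.indicator_nonneg (fun _ _ => zero_le_one) _)
    (h.flow_nonneg x y)

lemma one_le_N (h : IsOccupation w W o z N) : 1 ≤ N o := by
  have h1 := (h.balance o h.o_notMem).nonneg fun x => h.flow_nonneg x o
  simp only [if_true] at h1
  linarith

/-- Symmetrised energy bound: the quadratic form of a pair of functions satisfying the edge
inequality is at most the total occupation time plus the truncation error. -/
lemma flow_sum_le (h : IsOccupation w W o z N) {φ e : ℕ → ℝ} {K C : ℝ} (hC : 0 ≤ C)
    (hφ : ∀ x, |φ x| ≤ K) (he0 : ∀ x, 0 ≤ e x) (heN : ∀ x, e x ≤ N x / W x)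
    (hedge : ∀ x y, 0 < w x y → 2 * (N x / W x - N y / W y) * (φ y - φ x)
      ≤ N x / W x + N y / W y + C * (e x + e y)) :
    2 * ∑' q : ℕ × ℕ, zᶜ.indicator 1 q.2 * (φ q.2 - φ q.1) * (N q.1 / W q.1 * w q.1 q.2)
      ≤ ∑' x, N x + C * ∑' x, W x * e x := by
  set g : ℕ → ℝ := fun x => N x / W x with hg
  set F : ℕ × ℕ → ℝ := fun q => zᶜ.indicator 1 q.2 * (φ q.2 - φ q.1) * (g q.1 * w q.1 q.2)
    with hF
  have sF : Summable F := h.summable_mul_flow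
    (ψ := fun q => zᶜ.indicator 1 q.2 * (φ q.2 - φ q.1)) (K := 1 * (K + K)) fun q => by
      rw [abs_mul]
      exact mul_le_mul (abs_indicator_le _ _)
        ((abs_sub _ _).trans (add_le_add (hφ _) (hφ _))) (abs_nonneg _) zero_le_one
  have sF' : Summable fun q : ℕ × ℕ => F q.swap := (Equiv.prodComm ℕ ℕ).summable_iff.2 sF
  have tF' : ∑' q : ℕ × ℕ, F q.swap = ∑' q, F q := (Equiv.prodComm ℕ ℕ).tsum_eq F
  have main : ∀ u : ℕ → ℝ, (∀ x, 0 ≤ u x) → (∀ x, u x ≤ g x) →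
      HasSum (fun q : ℕ × ℕ => (u q.1 + u q.2) * w q.1 q.2) (2 * ∑' x, W x * u x) := by
    intro u hu0 hu
    have r1 : ∀ x, HasSum (fun y => u x * w x y) (W x * u x) := fun x => by
      rw [mul_comm]; exact (h.hasSum_w x).mul_left (u x)
    have s1 : Summable fun q : ℕ × ℕ => u q.1 * w q.1 q.2 :=
      Summable.of_nonneg_of_le (fun q => mul_nonneg (hu0 _) (h.w_nonneg _ _))
        (fun q => mul_le_mul_of_nonneg_right (hu _) (h.w_nonneg _ _)) h.summable_flow
    have t1 : HasSum (fun q : ℕ × ℕ => u q.1 * w q.1 q.2) (∑' x, W x * u x) := by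
      have := s1.hasSum
      rw [s1.tsum_prod] at this
      simpa only [(r1 _).tsum_eq] using this
    have t2 : HasSum (fun q : ℕ × ℕ => u q.2 * w q.1 q.2) (∑' x, W x * u x) := by
      refine ((Equiv.prodComm ℕ ℕ).hasSum_iff.2 t1).congr_fun fun q => ?_
      simp [h.w_symm q.1 q.2]
    rw [two_mul]
    simpa only [add_mul] using t1.add t2
  have t3 := main g (fun x => div_nonneg (h.N_nonneg x) (h.W_pos x).le) (fun _ => le_rfl)
  have t4 := (main e he0 heN).mul_left C
  have hWg : ∀ x, W x * g x = N x := fun x => mul_div_cancel₀ _ (h.W_pos x).ne'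
  simp only [hWg] at t3
  have hpt : ∀ q : ℕ × ℕ, 2 * (F q + F q.swap)
      ≤ (g q.1 + g q.2) * w q.1 q.2 + C * ((e q.1 + e q.2) * w q.1 q.2) := by
    rintro ⟨x, y⟩
    have hgx : 0 ≤ g x := div_nonneg (h.N_nonneg x) (h.W_pos x).le
    have hgy : 0 ≤ g y := div_nonneg (h.N_nonneg y) (h.W_pos y).le
    have hw := h.w_nonneg x y
    have hrhs : 0 ≤ (g x + g y) * w x y + C * ((e x + e y) * w x y) := by
      have := he0 x
      have := he0 y
      positivity
    simp only [hF, Prod.swap, ← h.w_symm x y]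
    by_cases hx : x ∈ z
    · have : g x = 0 := by simp [hg, h.N_eq_zero x hx]
      simpa [hx, this] using hrhs
    · by_cases hy : y ∈ z
      · have : g y = 0 := by simp [hg, h.N_eq_zero y hy]
        simpa [hy, this] using hrhs
      · rcases hw.eq_or_lt with hw0 | hw0
        · simp [← hw0]
        · have := mul_le_mul_of_nonneg_right (hedge x y hw0) hw
          simp only [Set.mem_compl_iff, hx, hy, not_false_eq_true, Set.indicator_of_mem,
            Pi.one_apply, one_mul]
          simp only [hg] at this ⊢
          linarith
  have t5 := hasSum_le hpt ((sF.hasSum.add (tF' ▸ sF'.hasSum)).mul_left 2) (t3.add t4)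
  linarith

end IsOccupation

namespace IsOccupation

variable {w : ℕ → ℕ → ℝ} {W : ℕ → ℝ} {o : ℕ} {z : Set ℕ} {N : ℕ → ℝ}

lemma hasSum_weight_into (h : IsOccupation w W o z N) {Wz : ℝ} (hWz : HasSum (z.indicator W) Wz) :
    HasSum (fun x => ∑' y, z.indicator 1 y * w x y) Wz := by
  have row : ∀ y, HasSum (fun x => z.indicator 1 y * w x y) (z.indicator W y) := by
    intro y
    have h1 : HasSum (fun x => w x y) (W y) := (h.hasSum_w y).congr_fun fun x => h.w_symm x y
    have := h1.mul_left (z.indicator (1 : ℕ → ℝ) y)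
    by_cases hy : y ∈ z
    · simpa [hy] using this
    · simp [hy]
  have nonneg : ∀ x y, 0 ≤ z.indicator (1 : ℕ → ℝ) y * w x y := fun x y =>
    mul_nonneg (Set.indicator_nonneg (fun _ _ => zero_le_one) _) (h.w_nonneg x y)
  have s1 : Summable fun q : ℕ × ℕ => z.indicator 1 q.1 * w q.2 q.1 := by
    rw [summable_prod_of_nonneg fun q => nonneg q.2 q.1]
    refine ⟨fun y => (row y).summable, ?_⟩
    simp only [(row _).tsum_eq]
    exact hWz.summable
  have s2 : Summable fun q : ℕ × ℕ => z.indicator 1 q.2 * w q.1 q.2 :=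
    (Equiv.prodComm ℕ ℕ).summable_iff.2 s1
  have s3 := s2.prod.hasSum
  have e : ∑' x, ∑' y, z.indicator 1 y * w x y = Wz := by
    rw [← hWz.tsum_eq, ← s2.tsum_prod, ← (Equiv.prodComm ℕ ℕ).tsum_eq]
    refine s1.tsum_prod.trans ?_
    simp only [(row _).tsum_eq]
  simpa only [e] using s3

lemma abs_log_clampTo_le {δ M : ℝ} (hδ : 0 < δ) (hM : δ ≤ M) (x : ℝ) :
    |Real.log (clampTo δ M x)| ≤ |Real.log δ| + |Real.log M| := by
  have h1 : Real.log δ ≤ Real.log (clampTo δ M x) := Real.log_le_log hδ (le_max_left _ _)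
  have h2 : Real.log (clampTo δ M x) ≤ Real.log M :=
    Real.log_le_log (lt_max_of_lt_left hδ) (max_le hM (min_le_left _ _))
  rw [abs_le]
  constructor
  · linarith [neg_abs_le (Real.log δ), abs_nonneg (Real.log M)]
  · linarith [le_abs_self (Real.log M), abs_nonneg (Real.log δ)]

lemma clampErr_nonneg {δ M x : ℝ} (hδ : 0 ≤ δ) (hM : δ ≤ M) (hx : 0 ≤ x) :
    0 ≤ clampErr δ M x := by
  rw [clampErr_eq hM]; positivity

lemma clampErr_le (δ M x : ℝ) : clampErr δ M x ≤ x := by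
  have : δ ≤ clampTo δ M x := le_max_left _ _
  unfold clampErr; linarith

lemma two_mul_sub_le_of_clamp (h : IsOccupation w W o z N) {Wz : ℝ}
    (hWz : HasSum (z.indicator W) Wz) {D : ℕ → ℝ} {m K : ℝ} (hD : ∀ x, |D x| ≤ K) (hDo : D o = 0)
    (hlip : ∀ x y, 0 < w x y → |D x - D y| ≤ 1)
    (hexit : ∀ x y, 0 < w x y → x ∉ z → y ∈ z → D x = m) {l δ M : ℝ} (hl : 0 ≤ l) (hδ : 0 < δ)
    (hδo : δ ≤ N o / W o) (hoM : N o / W o ≤ M) :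
    2 * (2 * l * m - l ^ 2 * Real.log (N o * (Wz / W o + 1)))
      ≤ ∑' x, N x + (4 * l + 1) * ∑' x, W x * clampErr δ M (N x / W x) := by
  have hM : δ ≤ M := hδo.trans hoM
  have hg : ∀ x, 0 ≤ N x / W x := fun x => div_nonneg (h.N_nonneg x) (h.W_pos x).le
  set G : ℕ → ℝ := fun x => clampTo δ M (N x / W x) with hG
  have hGpos : ∀ x, 0 < G x := fun x => lt_max_of_lt_left hδ
  set φ : ℕ → ℝ := fun x => 2 * l * D x + l ^ 2 * Real.log (G x) with hφ
  have hφb : ∀ x, |φ x| ≤ 2 * l * K + l ^ 2 * (|Real.log δ| + |Real.log M|) := by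
    intro x
    refine (abs_add_le _ _).trans ?_
    rw [abs_mul (2 * l), abs_mul (l ^ 2), abs_of_nonneg (by positivity : 0 ≤ 2 * l),
      abs_of_nonneg (by positivity : 0 ≤ l ^ 2)]
    gcongr
    · exact hD x
    · exact abs_log_clampTo_le hδ hM _
  have h1 := h.flow_sum_le (φ := φ) (e := fun x => clampErr δ M (N x / W x))
    (C := 4 * l + 1) (by positivity) hφb (fun x => clampErr_nonneg hδ.le hM (hg x))
    (fun x => clampErr_le _ _ _)
    (fun x y hxy => edge_inequality hδ hM hl (hg x) (hg y) (hlip x y hxy))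
  obtain ⟨s2, h2⟩ := h.green_identity hφb
  rw [h2] at h1
  refine le_trans ?_ h1
  have hWo := h.W_pos o
  have hWz0 : 0 ≤ Wz := hWz.nonneg fun x => Set.indicator_nonneg (fun y _ => (h.W_pos y).le) x
  have hMW : 1 / M ≤ W o := by
    have hMpos : 0 < M := hδ.trans_le hM
    rw [div_le_iff₀ hMpos]
    have := (div_le_iff₀ hWo).1 hoM
    linarith [h.one_le_N]
  set Q : ℝ := Wz + W o with hQ
  have hQpos : 0 < Q := by positivity
  have hpt : ∀ x, exitFlow w W z N x * (2 * l * m + l ^ 2 * (1 - Real.log Q))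
      - l ^ 2 / Q * ((∑' y, z.indicator 1 y * w x y) + exitFlow w W z N x * W o)
      ≤ φ x * exitFlow w W z N x := by
    intro x
    have ha0 := h.exitFlow_nonneg x
    have hab : exitFlow w W z N x = N x / W x * ∑' y, z.indicator 1 y * w x y := by
      rw [exitFlow, ← tsum_mul_left]
      exact tsum_congr fun y => by ring
    have hb0 : 0 ≤ ∑' y, z.indicator (1 : ℕ → ℝ) y * w x y := tsum_nonneg fun y =>
      mul_nonneg (Set.indicator_nonneg (fun _ _ => zero_le_one) _) (h.w_nonneg x y)
    rcases ha0.eq_or_lt with ha | ha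
    · rw [← ha]
      have : 0 ≤ l ^ 2 / Q * ((∑' y, z.indicator 1 y * w x y) + 0 * W o) := by positivity
      linarith
    have hDx : D x = m := by
      have hxz : x ∉ z := by
        intro hx
        simp [hab, h.N_eq_zero x hx] at ha
      by_contra hne
      have : ∀ y, z.indicator 1 y * (N x / W x * w x y) = 0 := by
        intro y
        by_cases hy : y ∈ z
        · rcases (h.w_nonneg x y).eq_or_lt with hw | hw
          · simp [← hw]
          · exact absurd (hexit x y hw hxz hy) hne
        · simp [hy]
      simp [exitFlow, this] at ha
    have hgx : 0 < N x / W x := by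
      refine (hg x).lt_of_ne' fun h0 => ?_
      simp [hab, h0] at ha
    have hinv : 1 / G x ≤ 1 / (N x / W x) + W o := by
      rcases le_total M (N x / W x) with hc | hc
      · have : M ≤ G x := (le_min le_rfl hc).trans (le_max_right _ _)
        have h3 : 1 / G x ≤ 1 / M := one_div_le_one_div_of_le (hδ.trans_le hM) this
        have : 0 < 1 / (N x / W x) := by positivity
        linarith
      · have : N x / W x ≤ G x := (le_min hc le_rfl).trans (le_max_right _ _)
        have h3 := one_div_le_one_div_of_le hgx this
        linarith
    have hlog := Real.one_sub_inv_le_log_of_pos (mul_pos hQpos (hGpos x))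
    rw [Real.log_mul hQpos.ne' (hGpos x).ne'] at hlog
    have h4 : exitFlow w W z N x * (1 / G x)
        ≤ (∑' y, z.indicator 1 y * w x y) + exitFlow w W z N x * W o := by
      refine (mul_le_mul_of_nonneg_left hinv ha0).trans_eq ?_
      rw [mul_add]
      congr 1
      rw [hab]
      rw [mul_right_comm, mul_one_div_cancel hgx.ne', one_mul]
    have h5 : (Q * G x)⁻¹ = 1 / Q * (1 / G x) := by field_simp
    simp only [hφ]
    rw [hDx]
    have h6 : exitFlow w W z N x * (1 - Real.log Q)
        - 1 / Q * ((∑' y, z.indicator 1 y * w x y) + exitFlow w W z N x * W o)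
        ≤ exitFlow w W z N x * Real.log (G x) := by
      have h7 : exitFlow w W z N x * (1 - Real.log Q - (Q * G x)⁻¹)
          ≤ exitFlow w W z N x * Real.log (G x) :=
        mul_le_mul_of_nonneg_left (by linarith) ha0
      have h8 : 1 / Q * (exitFlow w W z N x * (1 / G x)) ≤ 1 / Q *
          ((∑' y, z.indicator 1 y * w x y) + exitFlow w W z N x * W o) := by gcongr
      rw [h5] at h7
      linarith
    have h9 := mul_le_mul_of_nonneg_left h6 (sq_nonneg l)
    have h10 : l ^ 2 / Q = l ^ 2 * (1 / Q) := by ring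
    rw [h10]
    linarith
  have hA := h.hasSum_exitFlow
  have hsum := (hA.mul_right (2 * l * m + l ^ 2 * (1 - Real.log Q))).sub
    (((h.hasSum_weight_into hWz).add (hA.mul_right (W o))).mul_left (l ^ 2 / Q))
  have h11 := hasSum_le hpt hsum s2.hasSum
  have hφo : φ o = l ^ 2 * Real.log (N o / W o) := by
    have : clampTo δ M (N o / W o) = N o / W o := by
      unfold clampTo; rw [min_eq_right hoM, max_eq_right hδo]
    simp [hφ, hG, hDo, this]
  have hNo : 0 < N o := zero_lt_one.trans_le h.one_le_N
  have hlogeq : Real.log (N o * (Wz / W o + 1)) = Real.log (N o / W o) + Real.log Q := by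
    rw [← Real.log_mul (by positivity) hQpos.ne', hQ]
    congr 1
    field_simp
  have h12 : l ^ 2 / Q * (Wz + 1 * W o) = l ^ 2 := by
    rw [one_mul, ← hQ]; field_simp
  rw [h12] at h11
  rw [hφo, hlogeq]
  linarith

lemma tendsto_clampErr (h : IsOccupation w W o z N) :
    Tendsto (fun k : ℕ => ∑' x, W x * clampErr (1 / ((k : ℝ) + 1)) (k + 1) (N x / W x))
      atTop (nhds 0) := by
  have hg : ∀ x, 0 ≤ N x / W x := fun x => div_nonneg (h.N_nonneg x) (h.W_pos x).le
  have hle : ∀ k : ℕ, 1 / ((k : ℝ) + 1) ≤ k + 1 := fun k => by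
    have : (0 : ℝ) ≤ k := k.cast_nonneg
    rw [div_le_iff₀ (by positivity)]
    nlinarith
  have hnn : ∀ (k : ℕ) (x : ℕ), 0 ≤ clampErr (1 / ((k : ℝ) + 1)) (k + 1) (N x / W x) :=
    fun k x => clampErr_nonneg (by positivity) (hle k) (hg x)
  rw [← tsum_zero (α := ℝ) (β := ℕ)]
  refine tendsto_tsum_of_dominated_convergence (bound := N) h.summable_N (fun x => ?_) ?_
  · have h1 : Tendsto (fun k : ℕ => W x * (1 / ((k : ℝ) + 1))) atTop (nhds 0) := by
      simpa using tendsto_one_div_add_atTop_nhds_zero_nat.const_mul (W x)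
    refine tendsto_of_tendsto_of_tendsto_of_le_of_le' tendsto_const_nhds h1
      (Eventually.of_forall fun k => mul_nonneg (h.W_pos x).le (hnn k x)) ?_
    filter_upwards [eventually_ge_atTop ⌈N x / W x⌉₊] with k hk
    have hk' : N x / W x ≤ k + 1 := (Nat.ceil_le.1 hk).trans (by linarith)
    rw [clampErr_eq (hle k), max_eq_left (by linarith), add_zero]
    exact mul_le_mul_of_nonneg_left (min_le_right _ _) (h.W_pos x).le
  · refine Eventually.of_forall fun k x => ?_
    rw [Real.norm_of_nonneg (mul_nonneg (h.W_pos x).le (hnn k x))]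
    calc _ ≤ W x * (N x / W x) := mul_le_mul_of_nonneg_left (clampErr_le _ _ _) (h.W_pos x).le
      _ = N x := mul_div_cancel₀ _ (h.W_pos x).ne'

lemma two_mul_sub_le (h : IsOccupation w W o z N) {Wz : ℝ}
    (hWz : HasSum (z.indicator W) Wz) {D : ℕ → ℝ} {m K : ℝ} (hD : ∀ x, |D x| ≤ K) (hDo : D o = 0)
    (hlip : ∀ x y, 0 < w x y → |D x - D y| ≤ 1)
    (hexit : ∀ x y, 0 < w x y → x ∉ z → y ∈ z → D x = m) {l : ℝ} (hl : 0 ≤ l) :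
    2 * (2 * l * m - l ^ 2 * Real.log (N o * (Wz / W o + 1))) ≤ ∑' x, N x := by
  have hlim := (h.tendsto_clampErr.const_mul (4 * l + 1)).const_add (∑' x, N x)
  rw [mul_zero, add_zero] at hlim
  refine ge_of_tendsto hlim ?_
  have hgo : 0 < N o / W o := div_pos (zero_lt_one.trans_le h.one_le_N) (h.W_pos o)
  filter_upwards [eventually_ge_atTop ⌈N o / W o⌉₊,
    (tendsto_one_div_add_atTop_nhds_zero_nat (𝕜 := ℝ)).eventually_le_const hgo] with k hk hk2
  exact h.two_mul_sub_le_of_clamp hWz hD hDo hlip hexit hl (by positivity) hk2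
    ((Nat.ceil_le.1 hk).trans (by linarith))

/-- Optimising over the parameter. -/
lemma sq_div_log_le (h : IsOccupation w W o z N) {Wz : ℝ}
    (hWz : HasSum (z.indicator W) Wz) {D : ℕ → ℝ} {m K : ℝ} (hm : 0 ≤ m) (hD : ∀ x, |D x| ≤ K)
    (hDo : D o = 0) (hlip : ∀ x y, 0 < w x y → |D x - D y| ≤ 1)
    (hexit : ∀ x y, 0 < w x y → x ∉ z → y ∈ z → D x = m) {L : ℝ} (hL : 0 < L)
    (hlog : Real.log (N o * (Wz / W o + 1)) ≤ L) :
    2 * m ^ 2 / L ≤ ∑' x, N x := by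
  have := h.two_mul_sub_le hWz hD hDo hlip hexit (l := m / L) (by positivity)
  refine le_trans ?_ this
  have h1 : (m / L) ^ 2 * Real.log (N o * (Wz / W o + 1)) ≤ (m / L) ^ 2 * L := by gcongr
  have h2 : (m / L) ^ 2 * L = m ^ 2 / L := by field_simp
  have h3 : 2 * (m / L) * m = 2 * (m ^ 2 / L) := by ring
  have h4 : 2 * m ^ 2 / L = 2 * (m ^ 2 / L) := by ring
  linarith

end IsOccupation

/-! ### The lower bound -/

/-- `k = m`, or `x` can be reached from `o` in `k` steps. -/
def reachOrCap (G : WeightedGraph ℕ) (o m x k : ℕ) : Prop :=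
  k = m ∨ ∃ q : ℕ → ℕ, q 0 = o ∧ (∀ i, i < k → 0 < G.w (q i) (q (i + 1))) ∧ q k = x

/-- The graph distance from `o`, truncated at `m`. -/
noncomputable def truncDist (G : WeightedGraph ℕ) (o m x : ℕ) : ℕ :=
  sInf {k | reachOrCap G o m x k}

section TruncDist

variable {G : WeightedGraph ℕ} {o m : ℕ}

lemma truncDist_mem (x : ℕ) : reachOrCap G o m x (truncDist G o m x) :=
  Nat.sInf_mem (s := {k | reachOrCap G o m x k}) ⟨m, Or.inl rfl⟩

lemma truncDist_le (x : ℕ) : truncDist G o m x ≤ m := Nat.sInf_le (Or.inl rfl)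

lemma truncDist_self : truncDist G o m o = 0 :=
  Nat.le_zero.1 (Nat.sInf_le (Or.inr ⟨fun _ => o, rfl, by simp, rfl⟩))

lemma exists_path_extend {x y k : ℕ} (hxy : 0 < G.w x y)
    (h : ∃ q : ℕ → ℕ, q 0 = o ∧ (∀ i, i < k → 0 < G.w (q i) (q (i + 1))) ∧ q k = x) :
    ∃ q : ℕ → ℕ, q 0 = o ∧ (∀ i, i < k + 1 → 0 < G.w (q i) (q (i + 1))) ∧ q (k + 1) = y := by
  obtain ⟨q, h0, h1, h2⟩ := h
  refine ⟨fun i => if i ≤ k then q i else y, by simp [h0], fun i hi => ?_, by simp⟩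
  rcases Nat.lt_or_ge i k with hik | hik
  · simp only [if_pos hik.le, if_pos (Nat.succ_le_of_lt hik)]
    exact h1 i hik
  · obtain rfl : i = k := by omega
    simpa [h2] using hxy

lemma truncDist_le_succ {x y : ℕ} (hxy : 0 < G.w x y) :
    truncDist G o m y ≤ truncDist G o m x + 1 := by
  rcases truncDist_mem (G := G) (o := o) (m := m) x with h | h
  · rw [h]; exact (truncDist_le y).trans (Nat.le_succ m)
  · exact Nat.sInf_le (Or.inr (exists_path_extend hxy h))

lemma truncDist_eq_of_exit {n : ℕ} {z : Set ℕ} (hdist : G.distGE o z n) {x y : ℕ}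
    (hxy : 0 < G.w x y) (hy : y ∈ z) : truncDist G o (n - 1) x = n - 1 := by
  rcases truncDist_mem (G := G) (o := o) (m := n - 1) x with h | h
  · exact h
  · obtain ⟨q, h0, h1, h2⟩ := exists_path_extend hxy h
    have h3 := hdist _ q h0 h1 (h2 ▸ hy)
    have h4 := truncDist_le (G := G) (o := o) (m := n - 1) x
    omega

end TruncDist

lemma IsRandomWalk.isOccupation {G : WeightedGraph ℕ} {o : ℕ} {μ : Measure (ℕ → ℕ)} {z : Set ℕ}
    (hμ : IsRandomWalk G o μ) (ho : o ∉ z) (hfin : expHit μ z ≠ ⊤) :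
    IsOccupation (fun x y => (G.w x y).toReal) (fun x => (G.vw x).toReal) o z
      (fun x => (expVisits μ z x).toReal) := by
  rw [expHit_eq_tsum_expVisits] at hfin
  have hN : ∀ x, expVisits μ z x ≠ ⊤ := ENNReal.ne_top_of_tsum_ne_top hfin
  refine ⟨fun _ _ => ENNReal.toReal_nonneg, fun x y => by rw [G.symm],
    fun x => ?_,
    fun x => ENNReal.toReal_pos (G.vw_pos x).ne' (G.vw_lt_top x).ne,
    fun _ => ENNReal.toReal_nonneg, ENNReal.summable_toReal hfin, fun x hx => ?_, ho,
    fun y hy => ?_⟩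
  · have h1 := ENNReal.hasSum_toReal (G.vw_lt_top x).ne
    rwa [← ENNReal.tsum_toReal_eq (ENNReal.ne_top_of_tsum_ne_top (G.vw_lt_top x).ne)] at h1
  · simp only [hμ.expVisits_eq ho x, if_pos hx, ENNReal.toReal_zero]
  · have h1 := hμ.expVisits_eq ho y
    rw [if_neg hy] at h1
    have h2 : ∑' x, expVisits μ z x * G.trans x y ≠ ⊤ := fun h => hN y (by rw [h1, h, add_top])
    have h3 := ENNReal.hasSum_toReal h2
    have h4 : (∑' x, expVisits μ z x * G.trans x y).toReal
        = (expVisits μ z y).toReal - if y = o then 1 else 0 := by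
      rw [h1, ENNReal.toReal_add (by split_ifs <;> simp) h2]
      split_ifs <;> simp
    rw [← ENNReal.tsum_toReal_eq (ENNReal.ne_top_of_tsum_ne_top h2), h4] at h3
    refine h3.congr_fun fun x => ?_
    rw [ENNReal.toReal_mul, WeightedGraph.trans, ENNReal.toReal_div]
    ring

lemma IsRandomWalk.le_toReal_expHit {G : WeightedGraph ℕ} {o : ℕ} {μ : Measure (ℕ → ℕ)}
    {z : Set ℕ} (hμ : IsRandomWalk G o μ) {n : ℕ} (hn : 1 ≤ n) (hdist : G.distGE o z n)
    {R S : ℝ} (hR : G.setWeight z / G.vw o < ENNReal.ofReal R) (hfin : expHit μ z ≠ ⊤)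
    (hS : (expHit μ z).toReal ≤ S) (hL : 0 < Real.log (S * (R + 1))) :
    2 * ((n : ℝ) - 1) ^ 2 / Real.log (S * (R + 1)) ≤ (expHit μ z).toReal := by
  have ho : o ∉ z := fun ho => by
    have := hdist 0 (fun _ => o) rfl (by simp) ho
    omega
  have h := hμ.isOccupation ho hfin
  have hsum := expHit_eq_tsum_expVisits μ z
  have hfin' := hfin
  rw [hsum] at hfin'
  have hT : (expHit μ z).toReal = ∑' x, (expVisits μ z x).toReal := by
    rw [hsum, ENNReal.tsum_toReal_eq (ENNReal.ne_top_of_tsum_ne_top hfin')]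
  have hWo : (G.vw o).toReal ≠ 0 := (h.W_pos o).ne'
  have hvo : G.vw o ≠ ⊤ := (G.vw_lt_top o).ne
  have hz : G.setWeight z ≠ ⊤ := by
    intro hz
    rw [hz, ENNReal.top_div_of_ne_top hvo] at hR
    exact not_top_lt hR
  have hWz : HasSum (z.indicator fun x => (G.vw x).toReal) (G.setWeight z).toReal := by
    have e : G.setWeight z = ∑' x, z.indicator G.vw x := tsum_subtype z G.vw
    rw [e] at hz ⊢
    have := ENNReal.hasSum_toReal hz
    rw [← ENNReal.tsum_toReal_eq (ENNReal.ne_top_of_tsum_ne_top hz)] at this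
    refine this.congr_fun fun x => ?_
    by_cases hx : x ∈ z <;> simp [hx]
  have hpos : ∀ x y, 0 < (G.w x y).toReal → 0 < G.w x y := fun x y hxy =>
    (ENNReal.toReal_pos_iff.1 hxy).1
  have hRpos : 0 < R := by
    rw [← ENNReal.ofReal_pos]; exact bot_le.trans_lt hR
  have hratio : (G.setWeight z).toReal / (G.vw o).toReal ≤ R := by
    rw [← ENNReal.toReal_div]
    exact ENNReal.toReal_le_of_le_ofReal hRpos.le hR.le
  have hNo : (expVisits μ z o).toReal ≤ S := by
    refine le_trans ?_ hS
    rw [hT]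
    exact h.summable_N.le_tsum o fun x _ => ENNReal.toReal_nonneg
  have hNo1 := h.one_le_N
  have hcast : (((n - 1 : ℕ) : ℕ) : ℝ) = (n : ℝ) - 1 := by push_cast [hn]; ring
  rw [hT]
  refine h.sq_div_log_le hWz (D := fun x => (truncDist G o (n - 1) x : ℝ)) (K := (n - 1 : ℕ))
    (m := (n : ℝ) - 1) ?_ (fun x => ?_) (by simp [truncDist_self]) (fun x y hxy => ?_)
    (fun x y hxy _ hy => ?_) hL ?_
  · rw [← hcast]; positivity
  · rw [Nat.abs_cast]; exact_mod_cast truncDist_le x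
  · have h1 := truncDist_le_succ (o := o) (m := n - 1) (hpos x y hxy)
    have h2 := truncDist_le_succ (o := o) (m := n - 1) (G.symm x y ▸ hpos x y hxy)
    rw [abs_le]
    have h1' : (truncDist G o (n - 1) y : ℝ) ≤ truncDist G o (n - 1) x + 1 := by exact_mod_cast h1
    have h2' : (truncDist G o (n - 1) x : ℝ) ≤ truncDist G o (n - 1) y + 1 := by exact_mod_cast h2
    constructor <;> linarith
  · rw [truncDist_eq_of_exit hdist (hpos x y hxy) hy, hcast]
  · have hq : 0 ≤ (G.setWeight z).toReal / (G.vw o).toReal :=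
      div_nonneg ENNReal.toReal_nonneg ENNReal.toReal_nonneg
    refine Real.log_le_log (mul_pos (by linarith) (by linarith)) ?_
    have : 0 ≤ S := by linarith
    gcongr

/-! ### Walks on a segment -/

/-- Weights of the segment `{0, …, n}` with conductance `e i` between `i` and `i + 1`; the unused
vertices carry loops. -/
noncomputable def segmentWeight (e : ℕ → ℝ) (n x y : ℕ) : ℝ≥0∞ :=
  if x = y then (if n < x then 1 else 0)
  else if max x y = min x y + 1 ∧ max x y ≤ n then ENNReal.ofReal (e (min x y)) else 0

lemma segmentWeight_comm (e : ℕ → ℝ) (n x y : ℕ) :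
    segmentWeight e n x y = segmentWeight e n y x := by
  unfold segmentWeight
  rw [max_comm, min_comm]
  by_cases h : x = y
  · subst h; rfl
  · rw [if_neg h, if_neg (Ne.symm h)]

lemma segmentWeight_succ (e : ℕ → ℝ) {n x : ℕ} (hx : x < n) :
    segmentWeight e n x (x + 1) = ENNReal.ofReal (e x) := by
  simp [segmentWeight, Nat.succ_le_of_lt hx]

lemma segmentWeight_eq_zero (e : ℕ → ℝ) {n x y : ℕ} (hx : x ≤ n) (h1 : y ≠ x + 1)
    (h2 : x ≠ y + 1) : segmentWeight e n x y = 0 := by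
  unfold segmentWeight
  by_cases h : x = y
  · simp [h] at hx ⊢; omega
  · rw [if_neg h, if_neg (by omega)]

section Segment

variable {e : ℕ → ℝ} {n : ℕ}

lemma tsum_segmentWeight_zero (hn : 0 < n) (f : ℕ → ℝ≥0∞) :
    ∑' y, segmentWeight e n 0 y * f y = ENNReal.ofReal (e 0) * f 1 := by
  rw [tsum_eq_single 1 fun y hy => by
    rw [segmentWeight_eq_zero e (Nat.zero_le n) (by omega) (by omega), zero_mul]]
  rw [← segmentWeight_succ e hn]

lemma tsum_segmentWeight_mid {x : ℕ} (hx : x + 1 < n) (f : ℕ → ℝ≥0∞) :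
    ∑' y, segmentWeight e n (x + 1) y * f y
      = ENNReal.ofReal (e (x + 1)) * f (x + 2) + ENNReal.ofReal (e x) * f x := by
  rw [tsum_eq_sum (s := {x + 2, x}) fun y hy => by
    simp only [Finset.mem_insert, Finset.mem_singleton, not_or] at hy
    rw [segmentWeight_eq_zero e hx.le (by omega) (by omega), zero_mul]]
  rw [Finset.sum_pair (by omega), ← segmentWeight_succ e hx,
    ← segmentWeight_succ e (n := n) (x := x) (by omega), segmentWeight_comm e n x]

lemma tsum_segmentWeight_last {x : ℕ} (hx : x + 1 = n) :
    ∑' y, segmentWeight e n n y = ENNReal.ofReal (e x) := by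
  subst hx
  rw [tsum_eq_single x fun y hy => ?_]
  · rw [segmentWeight_comm, segmentWeight_succ e (Nat.lt_succ_self x)]
  · by_cases h : y = x + 1 + 1
    · subst h; simp [segmentWeight]
    · exact segmentWeight_eq_zero e le_rfl h (by omega)

lemma tsum_segmentWeight_outside {x : ℕ} (hx : n < x) :
    ∑' y, segmentWeight e n x y = 1 := by
  rw [tsum_eq_single x fun y hy => ?_]
  · simp [segmentWeight, hx]
  · rw [segmentWeight, if_neg (Ne.symm hy), if_neg (by omega)]

/-- The segment as a weighted graph. -/
noncomputable def segmentGraph (e : ℕ → ℝ) (n : ℕ) (he : ∀ i, 0 < e i) (hn : 0 < n) :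
    WeightedGraph ℕ :=
  have key : ∀ x, 0 < ∑' y, segmentWeight e n x y ∧ ∑' y, segmentWeight e n x y < ⊤ := by
    intro x
    rcases lt_trichotomy x n with h | h | h
    · rcases x with _ | x
      · have := tsum_segmentWeight_zero (e := e) hn 1
        simp only [Pi.one_apply, mul_one] at this
        rw [this]
        exact ⟨ENNReal.ofReal_pos.2 (he 0), ENNReal.ofReal_lt_top⟩
      · have := tsum_segmentWeight_mid (e := e) h 1
        simp only [Pi.one_apply, mul_one] at this
        rw [this]
        exact ⟨add_pos_of_pos_of_nonneg (ENNReal.ofReal_pos.2 (he _)) zero_le,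
          ENNReal.add_lt_top.2 ⟨ENNReal.ofReal_lt_top, ENNReal.ofReal_lt_top⟩⟩
    · subst h
      rw [tsum_segmentWeight_last (Nat.sub_add_cancel hn)]
      exact ⟨ENNReal.ofReal_pos.2 (he _), ENNReal.ofReal_lt_top⟩
    · rw [tsum_segmentWeight_outside h]; simp
  ⟨segmentWeight e n, segmentWeight_comm e n, fun x => (key x).1, fun x => (key x).2⟩

variable {he : ∀ i, 0 < e i} {hn : 0 < n}

lemma segmentGraph_distGE : (segmentGraph e n he hn).distGE 0 {n} n := by
  intro k q h0 hq hk
  have : ∀ i, i ≤ k → q i ≤ i := by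
    intro i
    induction i with
    | zero => intro _; rw [h0]
    | succ i ih =>
      intro hi
      have h1 := ih (by omega)
      by_contra hcon
      have h2 := hq i (by omega)
      have h3 : 0 < segmentWeight e n (q i) (q (i + 1)) := h2
      rw [segmentWeight, if_neg (by omega), if_neg (by omega)] at h3
      exact lt_irrefl _ h3
  have h1 := this k le_rfl
  rw [Set.mem_singleton_iff.1 hk] at h1
  exact h1

lemma segmentGraph_vw_zero : (segmentGraph e n he hn).vw 0 = ENNReal.ofReal (e 0) := by
  have := tsum_segmentWeight_zero (e := e) hn 1
  simp only [Pi.one_apply, mul_one] at this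
  exact this

lemma segmentGraph_setWeight :
    (segmentGraph e n he hn).setWeight {n} = ENNReal.ofReal (e (n - 1)) := by
  rw [WeightedGraph.setWeight, tsum_singleton n (segmentGraph e n he hn).vw]
  exact tsum_segmentWeight_last (Nat.sub_add_cancel hn)

/-- Expected time to cross from `i` to `i + 1`. -/
noncomputable def crossTime (e : ℕ → ℝ) (i : ℕ) : ℝ :=
  (2 * ∑ j ∈ Finset.range i, e j + e i) / e i

lemma crossTime_pos (he : ∀ i, 0 < e i) (i : ℕ) : 0 < crossTime e i :=
  div_pos (add_pos_of_nonneg_of_pos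
    (mul_nonneg zero_le_two (Finset.sum_nonneg fun j _ => (he j).le)) (he i)) (he i)

/-- Expected time to reach `n` from `x`. -/
noncomputable def segmentTime (e : ℕ → ℝ) (n x : ℕ) : ℝ := ∑ i ∈ Finset.Ico x n, crossTime e i

lemma segmentTime_nonneg (he : ∀ i, 0 < e i) (n x : ℕ) : 0 ≤ segmentTime e n x :=
  Finset.sum_nonneg fun i _ => (crossTime_pos he i).le

lemma segmentTime_eq {x : ℕ} (hx : x < n) :
    segmentTime e n x = crossTime e x + segmentTime e n (x + 1) :=
  Finset.sum_eq_sum_Ico_succ_bot hx _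

lemma expHit_segment_le {μ : Measure (ℕ → ℕ)} (hμ : IsRandomWalk (segmentGraph e n he hn) 0 μ) :
    expHit μ {n} ≤ ENNReal.ofReal (segmentTime e n 0) := by
  let f : ℕ → ℝ≥0∞ := fun x => if x ≤ n then ENNReal.ofReal (segmentTime e n x) else ⊤
  have hf : ∀ x, x ≤ n → f x = ENNReal.ofReal (segmentTime e n x) := fun x hx => if_pos hx
  have key := hμ.expHit_le (z := {n}) (by simp; omega) f ?_
  · rwa [hf 0 (Nat.zero_le n)] at key
  intro x hx
  set G := segmentGraph e n he hn with hG
  by_cases hxn : n < x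
  · have : f x = ⊤ := if_neg (by omega)
    rw [this]; exact le_top
  have hlt : x < n := by
    simp only [Set.mem_singleton_iff] at hx; omega
  suffices H : G.vw x + ∑' y, G.w x y * f y ≤ f x * G.vw x by
    have h1 : ∑' y, G.trans x y * f y = (∑' y, G.w x y * f y) / G.vw x := by
      rw [div_eq_mul_inv, ← ENNReal.tsum_mul_right]
      refine tsum_congr fun y => ?_
      rw [WeightedGraph.trans, div_eq_mul_inv]; ring
    have h2 : (1 : ℝ≥0∞) = G.vw x / G.vw x :=
      (ENNReal.div_self (G.vw_pos x).ne' (G.vw_lt_top x).ne).symm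
    rw [h1, h2, ← ENNReal.add_div]
    exact ENNReal.div_le_of_le_mul H
  have hv : G.vw x = ∑' y, segmentWeight e n x y * (1 : ℕ → ℝ≥0∞) y := by simp; rfl
  have hw : ∑' y, G.w x y * f y = ∑' y, segmentWeight e n x y * f y := rfl
  have hc := crossTime_pos he
  have hs := segmentTime_nonneg he n
  rw [hv, hw]
  rcases x with _ | x
  · rw [tsum_segmentWeight_zero hn, tsum_segmentWeight_zero hn, hf 1 (by omega),
      hf 0 (by omega), segmentTime_eq hlt, Pi.one_apply, mul_one]
    have := he 0
    rw [← ENNReal.ofReal_mul this.le, ← ENNReal.ofReal_add this.le (mul_nonneg this.le (hs _)),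
      ← ENNReal.ofReal_mul (add_nonneg (hc 0).le (hs _))]
    refine ENNReal.ofReal_le_ofReal (le_of_eq ?_)
    simp [crossTime, this.ne']
    ring
  · rw [tsum_segmentWeight_mid hlt, tsum_segmentWeight_mid hlt, hf (x + 2) (by omega),
      hf (x + 1) (by omega), hf x (by omega), segmentTime_eq (x := x) (by omega),
      segmentTime_eq (x := x + 1) (by omega), Pi.one_apply, Pi.one_apply, mul_one, mul_one]
    have h0 := he x
    have h1 := he (x + 1)
    have h2 := hc x
    have h3 := hc (x + 1)
    have h4 := hs (x + 1 + 1)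
    have h5 : crossTime e x * e x = 2 * ∑ j ∈ Finset.range x, e j + e x :=
      div_mul_cancel₀ _ h0.ne'
    have h6 : crossTime e (x + 1) * e (x + 1)
        = 2 * (∑ j ∈ Finset.range x, e j + e x) + e (x + 1) := by
      rw [← Finset.sum_range_succ]
      exact div_mul_cancel₀ _ h1.ne'
    rw [← ENNReal.ofReal_mul h1.le, ← ENNReal.ofReal_mul h0.le, ← ENNReal.ofReal_add h1.le h0.le,
      ← ENNReal.ofReal_add (by positivity) (by positivity),
      ← ENNReal.ofReal_add (by positivity) (by positivity),
      ← ENNReal.ofReal_mul (by positivity)]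
    refine ENNReal.ofReal_le_ofReal (le_of_eq ?_)
    linear_combination h5 - h6

end Segment

/-! ### A good segment -/

section GoodSegment

variable {g B : ℝ}

/-- Geometric conductances with ratio `g`, modified by a factor `B` at both ends. -/
noncomputable def geomWeight (g B : ℝ) (m i : ℕ) : ℝ :=
  if i = 0 then B else if i = m + 1 then g ^ (m + 1) / B else g ^ i

lemma geomWeight_pos (hg : 0 < g) (hB : 0 < B) (m i : ℕ) : 0 < geomWeight g B m i := by
  unfold geomWeight
  split_ifs <;> positivity

lemma geomWeight_sum (hg : 1 < g) {m i : ℕ} (hi : i ≤ m) :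
    ∑ j ∈ Finset.range (i + 1), geomWeight g B m j ≤ B + g ^ (i + 1) / (g - 1) := by
  have hg1 : 0 < g - 1 := by linarith
  have key : ∑ j ∈ Finset.range (i + 1), geomWeight g B m j = B + (g ^ (i + 1) - g) / (g - 1) := by
    induction i with
    | zero => simp [geomWeight]
    | succ i ih =>
      rw [Finset.sum_range_succ, ih (by omega), geomWeight, if_neg (by omega), if_neg (by omega)]
      field_simp
      ring
  rw [key]
  gcongr
  linarith

lemma geomWeight_crossTime_mid (hg : 1 < g) {m i : ℕ} (hi : i < m) :
    crossTime (geomWeight g B m) (i + 1) ≤ 1 + 2 / (g - 1) + 2 * B * (1 / g ^ (i + 1)) := by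
  have hg1 : 0 < g - 1 := by linarith
  have h : geomWeight g B m (i + 1) = g ^ (i + 1) := by
    rw [geomWeight, if_neg (by omega), if_neg (by omega)]
  have hp : 0 < g ^ (i + 1) := by positivity
  rw [crossTime, h, div_le_iff₀ hp]
  have := geomWeight_sum (B := B) hg hi.le
  have e : (1 + 2 / (g - 1) + 2 * B * (1 / g ^ (i + 1))) * g ^ (i + 1)
      = 2 * (B + g ^ (i + 1) / (g - 1)) + g ^ (i + 1) := by
    field_simp
    ring
  rw [e]; linarith

lemma geomWeight_crossTime_last (hg : 1 < g) (hB : 0 < B) (m : ℕ) :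
    crossTime (geomWeight g B m) (m + 1) ≤ 1 + 2 * B / (g - 1) + 2 * (B ^ 2 / g ^ (m + 1)) := by
  have hg1 : 0 < g - 1 := by linarith
  have h : geomWeight g B m (m + 1) = g ^ (m + 1) / B := by
    rw [geomWeight, if_neg (by omega), if_pos rfl]
  have hp : 0 < g ^ (m + 1) / B := by positivity
  rw [crossTime, h, div_le_iff₀ hp]
  have := geomWeight_sum (B := B) hg (le_refl m)
  have e : (1 + 2 * B / (g - 1) + 2 * (B ^ 2 / g ^ (m + 1))) * (g ^ (m + 1) / B)
      = 2 * (B + g ^ (m + 1) / (g - 1)) + g ^ (m + 1) / B := by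
    field_simp
    ring
  rw [e]; linarith

lemma geomWeight_crossTime_zero (hB : 0 < B) (m : ℕ) : crossTime (geomWeight g B m) 0 = 1 := by
  simp [crossTime, geomWeight, hB.ne']

lemma sum_one_div_pow_succ_le (hg : 1 < g) (m : ℕ) :
    ∑ i ∈ Finset.range m, 1 / g ^ (i + 1) ≤ 1 / (g - 1) := by
  have hg1 : 0 < g - 1 := by linarith
  have key : ∑ i ∈ Finset.range m, 1 / g ^ (i + 1) = 1 / (g - 1) - 1 / g ^ m / (g - 1) := by
    induction m with
    | zero => simp
    | succ m ih =>
      rw [Finset.sum_range_succ, ih]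
      field_simp
      ring
  rw [key]
  have : 0 ≤ 1 / g ^ m / (g - 1) := by positivity
  linarith

lemma geomWeight_segmentTime_le (hg : 1 < g) (hB : 0 < B) (m : ℕ) :
    segmentTime (geomWeight g B m) (m + 2) 0
      ≤ (m + 2) + 2 * ((m + 2 * B) / (g - 1) + B ^ 2 / g ^ (m + 1)) := by
  rw [segmentTime, ← Finset.range_eq_Ico, Finset.sum_range_succ, Finset.sum_range_succ',
    geomWeight_crossTime_zero hB]
  have h1 : ∑ i ∈ Finset.range m, crossTime (geomWeight g B m) (i + 1)
      ≤ m * (1 + 2 / (g - 1)) + 2 * B * (1 / (g - 1)) := by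
    calc _ ≤ ∑ i ∈ Finset.range m, (1 + 2 / (g - 1) + 2 * B * (1 / g ^ (i + 1))) :=
          Finset.sum_le_sum fun i hi => geomWeight_crossTime_mid hg (Finset.mem_range.1 hi)
      _ = m * (1 + 2 / (g - 1)) + 2 * B * ∑ i ∈ Finset.range m, 1 / g ^ (i + 1) := by
          rw [Finset.sum_add_distrib, ← Finset.mul_sum]; simp [mul_add]
      _ ≤ _ := by gcongr; exact sum_one_div_pow_succ_le hg m
  have h2 := geomWeight_crossTime_last hg hB m
  have e : ((m : ℝ) + 2) + 2 * ((m + 2 * B) / (g - 1) + B ^ 2 / g ^ (m + 1))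
      = m * (1 + 2 / (g - 1)) + 2 * B * (1 / (g - 1)) + 1
        + (1 + 2 * B / (g - 1) + 2 * (B ^ 2 / g ^ (m + 1))) := by
    ring
  rw [e]; linarith

end GoodSegment

/-- Upper bound on the infimum coming from a segment with total weight ratio `X / B ^ 2`. -/
lemma sInf_ETsetPoly_le {c p : ℝ} {n : ℕ} (hn : 2 ≤ n) {X B : ℝ} (hX : 1 < X) (hB : 0 < B)
    (hXB : X / B ^ 2 < c * (n : ℝ) ^ p) :
    sInf (ETsetPoly c p n) ≤ ENNReal.ofReal
      (n + 2 * ((n + 2 * B) * (n - 1) / Real.log X + B ^ 2 / X)) := by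
  obtain ⟨m, rfl⟩ := Nat.exists_eq_add_of_le' hn
  set s := Real.log X / (m + 1) with hs
  have hlog : 0 < Real.log X := Real.log_pos hX
  have hm : (0 : ℝ) < m + 1 := by positivity
  have hspos : 0 < s := div_pos hlog hm
  have hg : 1 < Real.exp s := Real.one_lt_exp_iff.2 hspos
  have hgs : s ≤ Real.exp s - 1 := by linarith [Real.add_one_le_exp s]
  have hgX : Real.exp s ^ (m + 1) = X := by
    rw [← Real.exp_nat_mul, hs]
    push_cast
    rw [mul_div_cancel₀ _ hm.ne', Real.exp_log (by linarith)]
  have he := geomWeight_pos (Real.exp_pos s) hB m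
  obtain ⟨μ, hμ⟩ := exists_isRandomWalk (segmentGraph _ (m + 2) he (by omega)) 0
  have hmem := expHit_segment_le hμ
  have hin : expHit μ {m + 2} ∈ ETsetPoly c p (m + 2) := by
    refine ⟨_, 0, {m + 2}, μ, hμ, segmentGraph_distGE, ?_, rfl⟩
    rw [segmentGraph_setWeight, segmentGraph_vw_zero, ← ENNReal.ofReal_div_of_pos (he 0)]
    have h1 : geomWeight (Real.exp s) B m (m + 2 - 1) = X / B := by
      rw [geomWeight, if_neg (by omega), if_pos (by omega), hgX]
    have h0 : geomWeight (Real.exp s) B m 0 = B := if_pos rfl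
    rw [h1, h0, div_div, ← sq]
    refine (ENNReal.ofReal_lt_ofReal_iff (lt_of_le_of_lt ?_ hXB)).2 hXB
    positivity
  refine (sInf_le hin).trans (hmem.trans (ENNReal.ofReal_le_ofReal ?_))
  refine (geomWeight_segmentTime_le hg hB m).trans ?_
  rw [hgX]
  push_cast
  have e : ((m : ℝ) + 2 + 2 * B) * (m + 2 - 1) / Real.log X = (m + 2 + 2 * B) / s := by
    rw [hs]; field_simp; ring
  rw [e]
  gcongr
  linarith

/-- Lower bound on the infimum. -/
lemma le_sInf_ETsetPoly {c p : ℝ} {n : ℕ} (hn : 1 ≤ n)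
    (hL : 2 ≤ Real.log ((n : ℝ) ^ 2 * (c * (n : ℝ) ^ p + 1))) :
    ENNReal.ofReal (2 * ((n : ℝ) - 1) ^ 2 / Real.log ((n : ℝ) ^ 2 * (c * (n : ℝ) ^ p + 1)))
      ≤ sInf (ETsetPoly c p n) := by
  refine le_sInf ?_
  rintro _ ⟨G, o, z, μ, hμ, hdist, hR, rfl⟩
  by_cases hfin : expHit μ z = ⊤
  · rw [hfin]; exact le_top
  rw [ENNReal.ofReal_le_iff_le_toReal hfin]
  rcases le_total (expHit μ z).toReal ((n : ℝ) ^ 2) with hS | hS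
  · exact hμ.le_toReal_expHit hn hdist hR hfin hS (by linarith)
  · refine le_trans ?_ hS
    rw [div_le_iff₀ (by linarith)]
    have : (1 : ℝ) ≤ n := by exact_mod_cast hn
    nlinarith [sq_nonneg (n : ℝ)]

/-! ### Asymptotics -/

section Asymptotics

variable {c p : ℝ}

lemma tendsto_lowerLog_div_log (hc : 0 < c) (hp : 0 < p) :
    Tendsto (fun x : ℝ => Real.log (x ^ 2 * (c * x ^ p + 1)) / Real.log x) atTop
      (nhds (p + 2)) := by
  have h0 : Tendsto (fun x : ℝ => x ^ (-p)) atTop (nhds 0) := tendsto_rpow_neg_atTop hp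
  have h1 : Tendsto (fun x : ℝ => Real.log (c + x ^ (-p))) atTop (nhds (Real.log (c + 0))) :=
    (h0.const_add c).log (by simpa using hc.ne')
  have h2 := h1.div_atTop Real.tendsto_log_atTop
  have h3 := h2.const_add (p + 2)
  rw [add_zero] at h3
  refine h3.congr' ?_
  filter_upwards [eventually_gt_atTop 1] with x hx
  have hx0 : 0 < x := by linarith
  have hl : Real.log x ≠ 0 := (Real.log_pos hx).ne'
  have e : x ^ 2 * (c * x ^ p + 1) = x ^ 2 * x ^ p * (c + x ^ (-p)) := by
    rw [Real.rpow_neg hx0.le]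
    have : x ^ p ≠ 0 := (Real.rpow_pos_of_pos hx0 p).ne'
    field_simp
  have hp1 := Real.rpow_pos_of_pos hx0 p
  have hp2 := Real.rpow_pos_of_pos hx0 (-p)
  rw [e, Real.log_mul (by positivity) (by positivity), Real.log_mul (by positivity) hp1.ne',
    Real.log_pow, Real.log_rpow hx0]
  field_simp
  push_cast
  ring

lemma tendsto_lower_ratio (hc : 0 < c) (hp : 0 < p) :
    Tendsto (fun x : ℝ => 2 * (x - 1) ^ 2 / Real.log (x ^ 2 * (c * x ^ p + 1))
      / (2 * x ^ 2 / ((p + 2) * Real.log x))) atTop (nhds 1) := by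
  have hp2 : p + 2 ≠ 0 := by linarith
  have h1 := (tendsto_inv_atTop_zero (𝕜 := ℝ)).const_sub 1
  have h2 := ((h1.pow 2).mul_const (p + 2)).div (tendsto_lowerLog_div_log hc hp) hp2
  rw [sub_zero, one_pow, one_mul, div_self hp2] at h2
  refine h2.congr' ?_
  filter_upwards [eventually_gt_atTop 1] with x hx
  have hx0 : x ≠ 0 := by linarith
  have hl : Real.log x ≠ 0 := (Real.log_pos hx).ne'
  simp only [Pi.div_apply]
  field_simp

lemma tendsto_lowerLog_atTop (hc : 0 < c) (hp : 0 < p) :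
    Tendsto (fun x : ℝ => Real.log (x ^ 2 * (c * x ^ p + 1))) atTop atTop := by
  have h := (tendsto_lowerLog_div_log hc hp).pos_mul_atTop (by linarith) Real.tendsto_log_atTop
  refine h.congr' ?_
  filter_upwards [eventually_gt_atTop 1] with x hx
  exact div_mul_cancel₀ _ (Real.log_pos hx).ne'

lemma tendsto_upperLog_div_log (hc : 0 < c) :
    Tendsto (fun x : ℝ => Real.log (c / 2 * x ^ p * (x / Real.log x) ^ 2) / Real.log x) atTop
      (nhds (p + 2)) := by
  have h1 : Tendsto (fun x : ℝ => Real.log (c / 2) / Real.log x) atTop (nhds 0) :=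
    tendsto_const_nhds.div_atTop Real.tendsto_log_atTop
  have h2 : Tendsto (fun x : ℝ => Real.log (Real.log x) / Real.log x) atTop (nhds 0) :=
    Real.isLittleO_log_id_atTop.tendsto_div_nhds_zero.comp Real.tendsto_log_atTop
  have h3 := (h1.add_const (p + 2)).sub (h2.const_mul 2)
  rw [mul_zero, zero_add, sub_zero] at h3
  refine h3.congr' ?_
  filter_upwards [eventually_gt_atTop 1] with x hx
  have hx0 : 0 < x := by linarith
  have hl : 0 < Real.log x := Real.log_pos hx
  have hp1 := Real.rpow_pos_of_pos hx0 p
  rw [Real.log_mul (by positivity) (by positivity), Real.log_mul (by positivity) hp1.ne',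
    Real.log_pow, Real.log_rpow hx0, Real.log_div hx0.ne' hl.ne']
  field_simp
  push_cast
  ring

lemma tendsto_upper_ratio (hc : 0 < c) (hp : 0 < p) :
    Tendsto (fun x : ℝ =>
      (x + 2 * ((x + 2 * (x / Real.log x)) * (x - 1)
          / Real.log (c / 2 * x ^ p * (x / Real.log x) ^ 2)
        + (x / Real.log x) ^ 2 / (c / 2 * x ^ p * (x / Real.log x) ^ 2)))
      / (2 * x ^ 2 / ((p + 2) * Real.log x))) atTop (nhds 1) := by
  have hp2 : p + 2 ≠ 0 := by linarith
  have hinv := tendsto_inv_atTop_zero (𝕜 := ℝ)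
  have h1 : Tendsto (fun x : ℝ => Real.log x / x) atTop (nhds 0) :=
    Real.isLittleO_log_id_atTop.tendsto_div_nhds_zero
  have h2 : Tendsto (fun x : ℝ => 1 + 2 * (Real.log x)⁻¹) atTop (nhds (1 + 2 * 0)) :=
    ((hinv.comp Real.tendsto_log_atTop).const_mul 2).const_add 1
  have h3 := hinv.const_sub 1
  have h4 : Tendsto (fun x : ℝ => x ^ (-p)) atTop (nhds 0) := tendsto_rpow_neg_atTop hp
  have h5 := (((h2.mul h3).mul_const (p + 2)).div (tendsto_upperLog_div_log (p := p) hc) hp2)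
  have h6 := ((h1.mul_const ((p + 2) / 2)).add h5).add
    ((h4.mul (h1.mul hinv)).mul_const ((p + 2) * (2 / c)))
  simp only [mul_zero, zero_mul, add_zero, sub_zero, one_mul, zero_add, div_self hp2] at h6
  refine h6.congr' ?_
  filter_upwards [eventually_gt_atTop 1] with x hx
  have hx0 : 0 < x := by linarith
  have hl : 0 < Real.log x := Real.log_pos hx
  have hp1 := Real.rpow_pos_of_pos hx0 p
  simp only [Pi.div_apply, Real.rpow_neg hx0.le]
  have e : (x / Real.log x) ^ 2 / (c / 2 * x ^ p * (x / Real.log x) ^ 2) = 2 / c * (x ^ p)⁻¹ := by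
    field_simp
  rw [e]
  generalize Real.log (c / 2 * x ^ p * (x / Real.log x) ^ 2) = Y
  by_cases hY : Y = 0
  · subst hY
    simp only [div_zero, zero_div]
    field_simp
    ring
  field_simp
  ring

lemma tendsto_upperX_atTop (hc : 0 < c) (hp : 0 < p) :
    Tendsto (fun x : ℝ => c / 2 * x ^ p * (x / Real.log x) ^ 2) atTop atTop := by
  have h := (tendsto_upperLog_div_log (p := p) hc).pos_mul_atTop (by linarith)
    Real.tendsto_log_atTop
  refine (Real.tendsto_exp_atTop.comp h).congr' ?_
  filter_upwards [eventually_gt_atTop 1] with x hx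
  have hx0 : 0 < x := by linarith
  have hl : 0 < Real.log x := Real.log_pos hx
  have hp1 := Real.rpow_pos_of_pos hx0 p
  rw [Function.comp_apply, div_mul_cancel₀ _ hl.ne', Real.exp_log (by positivity)]

end Asymptotics

/-- In the polynomial scaling, `inf_G E T_{oz} ∼ 2n²/((p+2) log n)`,
the infimum being over weighted graphs with `dist(o,z) ≥ n` and `w_z/w_o < c n^p`. -/
theorem inf_expected_hitting_time_asymptotics
    (c p : ℝ) (hc : 0 < c) (hp : 0 < p) :
    Tendsto
      (fun n : ℕ =>
        (sInf (ETsetPoly c p n)).toReal / (2 * (n : ℝ) ^ 2 / ((p + 2) * Real.log n)))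
      atTop (nhds 1) := by
  have hcast := tendsto_natCast_atTop_atTop (R := ℝ)
  have hbounds : ∀ᶠ n : ℕ in atTop,
      2 * ((n : ℝ) - 1) ^ 2 / Real.log ((n : ℝ) ^ 2 * (c * (n : ℝ) ^ p + 1))
          ≤ (sInf (ETsetPoly c p n)).toReal ∧
        (sInf (ETsetPoly c p n)).toReal ≤ n + 2 * ((n + 2 * (n / Real.log n)) * (n - 1)
            / Real.log (c / 2 * (n : ℝ) ^ p * (n / Real.log n) ^ 2)
          + (n / Real.log n) ^ 2 / (c / 2 * (n : ℝ) ^ p * (n / Real.log n) ^ 2)) := by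
    filter_upwards [eventually_ge_atTop 2, hcast.eventually ((tendsto_lowerLog_atTop hc
      hp).eventually_ge_atTop 2), hcast.eventually ((tendsto_upperX_atTop hc
      hp).eventually_gt_atTop 1)] with n hn hL hX
    have hn1 : (1 : ℝ) < n := by exact_mod_cast hn
    have hB : 0 < (n : ℝ) / Real.log n := div_pos (by linarith) (Real.log_pos hn1)
    have hpow : 0 < (n : ℝ) ^ p := Real.rpow_pos_of_pos (by linarith) p
    have hup := sInf_ETsetPoly_le (c := c) (p := p) hn hX hB (by
      rw [mul_div_cancel_right₀ _ (by positivity)]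
      nlinarith [mul_pos hc hpow])
    have hlow := le_sInf_ETsetPoly (c := c) (p := p) (by omega : 1 ≤ n) hL
    refine ⟨(ENNReal.ofReal_le_iff_le_toReal (hup.trans_lt ENNReal.ofReal_lt_top).ne).1 hlow,
      ENNReal.toReal_le_of_le_ofReal ?_ hup⟩
    have hlogX := Real.log_pos hX
    have : (0 : ℝ) ≤ n - 1 := by linarith
    positivity
  have hR : ∀ n : ℕ, 0 ≤ 2 * (n : ℝ) ^ 2 / ((p + 2) * Real.log n) := fun n =>
    div_nonneg (by positivity) (mul_nonneg (by linarith) (Real.log_natCast_nonneg n))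
  refine tendsto_of_tendsto_of_tendsto_of_le_of_le' ((tendsto_lower_ratio hc hp).comp hcast)
    ((tendsto_upper_ratio hc hp).comp hcast) ?_ ?_
  · filter_upwards [hbounds] with n hn
    exact div_le_div_of_nonneg_right hn.1 (hR n)
  · filter_upwards [hbounds] with n hn
    exact div_le_div_of_nonneg_right hn.2 (hR n)

end RWHitting
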